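/- Let B be a unital von Neumann algebra, I a set, and for every ι ∈ I let A_ι be a unital von Neumann algebra containing a copy of B as a unital von Neumann subalgebra, with a normal conditional expectation φ_ι : A_ι → B whose GNS representation is faithful. Let (A,φ) = (*̄_B)_{ι∈I}(A_ι,φ_ι) be the amalgamated free product of von Neumann algebras. Then for every ι₀ ∈ I there exists a NORMAL conditional expectation Φ_{ι₀} : A → A_{ι₀} such that Φ_{ι₀} restricted to A_ι equals φ_ι for every ι ∈ I\{ι₀}, and Φ_{ι₀}(a₁a₂⋯aₙ) = 0 whenever n ≥ 2 and a_j ∈ A_{ι_j} ∩ ker φ_{ι_j} with ι₁ ≠ ι₂, …, ι_{n−1} ≠ ιₙ. -/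

import Mathlib

noncomputable section

/-- A conditional expectation from a unital C⋆-algebra `A` onto a unital C⋆-subalgebra
(the range of the unital embedding `j : B →⋆ₐ[ℂ] A`): a positive, `B`–`B`-bimodule,
idempotent (i.e. restricting to the identity on `B`) contraction. -/
structure IsCondExp {B A : Type*} [CStarAlgebra B] [CStarAlgebra A]
    (j : B →⋆ₐ[ℂ] A) (E : A →ₗ[ℂ] B) : Prop where
  injective : Function.Injective j
  left_inverse : ∀ b : B, E (j b) = b
  bimodule : ∀ (b₁ b₂ : B) (a : A), E (j b₁ * a * j b₂) = b₁ * E a * b₂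
  positive : ∀ a : A, ∃ b : B, E (star a * a) = star b * b
  contractive : ∀ a : A, ‖E a‖ ≤ ‖a‖

/-- The GNS representation of a conditional expectation `E : A → B` (i.e. the left action
of `A` on the Hilbert `B`-module `L²(A,E)` obtained from `A` by separation and completion
with respect to the `B`-valued inner product `⟨a₁, a₂⟩ = E (a₁⋆ * a₂)`) is faithful:
`a` acts as zero on the image of `A` in `L²(A,E)` only if `a = 0`. -/
def FaithfulGNS {B A : Type*} [CStarAlgebra B] [CStarAlgebra A] (E : A →ₗ[ℂ] B) : Prop :=
  ∀ a : A, (∀ x : A, E (star (a * x) * (a * x)) = 0) → a = 0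

/-- `(C, jC, emb, E)` is the reduced amalgamated free product of the unital C⋆-algebras
`A i` over `B` with respect to the conditional expectations `φ i : A i → B` (each having
faithful GNS representation): the `A i` embed into `C` compatibly with the copies of `B`,
`E` is a conditional expectation onto `B` with faithful GNS representation restricting to
`φ i` on each `A i`, the family of copies of the `A i` is free with respect to `E`, and
the copies of the `A i` together generate `C` as a C⋆-algebra.  These properties
characterize the reduced amalgamated free product `(A,φ) = (*_B)_{i ∈ I} (A i, φ i)`
up to canonical isomorphism. -/
structure IsReducedAmalgProd (B : Type*) [CStarAlgebra B] {I : Type*} {A : I → Type*}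
    [∀ i, CStarAlgebra (A i)] (jB : ∀ i, B →⋆ₐ[ℂ] A i) (φ : ∀ i, A i →ₗ[ℂ] B)
    {C : Type*} [CStarAlgebra C] (jC : B →⋆ₐ[ℂ] C) (emb : ∀ i, A i →⋆ₐ[ℂ] C)
    (E : C →ₗ[ℂ] B) : Prop where
  emb_injective : ∀ i, Function.Injective (emb i)
  compat : ∀ i, (emb i).comp (jB i) = jC
  condExp : IsCondExp jC E
  restrict : ∀ i (a : A i), E (emb i a) = φ i a
  faithful : FaithfulGNS E
  free : ∀ (n : ℕ) (ι : Fin (n + 1) → I), (∀ k : Fin n, ι k.castSucc ≠ ι k.succ) →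
    ∀ a : (j : Fin (n + 1)) → A (ι j), (∀ j, φ (ι j) (a j) = 0) →
      E ((List.ofFn fun j => emb (ι j) (a j)).prod) = 0
  generating :
    Dense ((StarAlgebra.adjoin ℂ (⋃ i, Set.range (emb i)) : StarSubalgebra ℂ C) : Set C)

open scoped ComplexOrder

/-- A positive linear functional `f` on a von Neumann algebra `M` is *normal* if it is
completely additive, i.e. it preserves the suprema of nonempty bounded directed families
of elements of `M` (equivalently, `f` is σ-weakly continuous). -/
def IsNormalPosFunctional {M : Type*} [CStarAlgebra M] [PartialOrder M]
    (f : M →ₗ[ℂ] ℂ) : Prop :=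
  (∀ a : M, ∃ c : ℂ, f (star a * a) = star c * c) ∧
  ∀ (s : Set M) (x : M), s.Nonempty → DirectedOn (· ≤ ·) s → IsLUB s x →
    Filter.Tendsto (fun p : s => f p) Filter.atTop (nhds (f x))

/-- The σ-weak topology on a von Neumann algebra `M`: the weak topology `σ(M, M_⋆)`
induced by the predual `M_⋆`, i.e. by the normal (positive) linear functionals on `M`. -/
def sigmaWeak (M : Type*) [CStarAlgebra M] [PartialOrder M] : TopologicalSpace M :=
  TopologicalSpace.induced
    (fun m => fun f : { f : M →ₗ[ℂ] ℂ // IsNormalPosFunctional f } => f.1 m) inferInstance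

/-- A map between von Neumann algebras is *normal* if it is σ-weakly continuous. -/
def IsNormalMap {M N : Type*} [CStarAlgebra M] [PartialOrder M] [CStarAlgebra N]
    [PartialOrder N] (θ : M → N) : Prop :=
  @Continuous M N (sigmaWeak M) (sigmaWeak N) θ

/-- A normal state on a von Neumann algebra: a unital normal positive linear
functional. -/
def IsNormalState {M : Type*} [CStarAlgebra M] [PartialOrder M] (ψ : M →ₗ[ℂ] ℂ) : Prop :=
  ψ 1 = 1 ∧ IsNormalPosFunctional ψ

/-- `(M, jC, emb, E)` is the amalgamated free product
`(A, φ) = (⋆̄_B)_{i ∈ I}(A i, φ i)` of the von Neumann algebras `A i` over `B` with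
respect to the normal conditional expectations `φ i : A i → B` (each having faithful GNS
representation).  It is obtained from the C⋆-algebra reduced amalgamated free product
`(𝒜, φ₀)` by taking the weak closure in the GNS representation of the state `ψ ∘ φ₀`,
for any normal state `ψ` on `B` with faithful GNS representation, and is characterized
by the following properties: the `A i` embed normally into `M` compatibly with the
copies of `B`, `E` is a normal conditional expectation onto `B` with faithful GNS
representation restricting to `φ i` on each `A i`, the family of copies of the `A i` is
free with respect to `E`, and the copies of the `A i` generate `M` as a von Neumann
algebra (i.e. they generate a σ-weakly dense ⋆-subalgebra). -/
structure IsVNAmalgProd (B : Type*) [CStarAlgebra B] [PartialOrder B] [StarOrderedRing B]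
    [WStarAlgebra B] {I : Type*} {A : I → Type*} [∀ i, CStarAlgebra (A i)]
    [∀ i, PartialOrder (A i)] [∀ i, StarOrderedRing (A i)] [∀ i, WStarAlgebra (A i)]
    (jB : ∀ i, B →⋆ₐ[ℂ] A i) (φ : ∀ i, A i →ₗ[ℂ] B)
    {M : Type*} [CStarAlgebra M] [PartialOrder M] [StarOrderedRing M] [WStarAlgebra M]
    (jC : B →⋆ₐ[ℂ] M) (emb : ∀ i, A i →⋆ₐ[ℂ] M) (E : M →ₗ[ℂ] B) : Prop where
  emb_injective : ∀ i, Function.Injective (emb i)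
  emb_normal : ∀ i, IsNormalMap (emb i)
  compat : ∀ i, (emb i).comp (jB i) = jC
  condExp : IsCondExp jC E
  normal : IsNormalMap E
  restrict : ∀ i (a : A i), E (emb i a) = φ i a
  faithful : FaithfulGNS E
  free : ∀ (n : ℕ) (ι : Fin (n + 1) → I), (∀ k : Fin n, ι k.castSucc ≠ ι k.succ) →
    ∀ a : (j : Fin (n + 1)) → A (ι j), (∀ j, φ (ι j) (a j) = 0) →
      E ((List.ofFn fun j => emb (ι j) (a j)).prod) = 0
  generating : @Dense M (sigmaWeak M)
    ((StarAlgebra.adjoin ℂ (⋃ i, Set.range (emb i)) : StarSubalgebra ℂ M) : Set M)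

namespace FreeFactor

open Filter Topology

universe u

section Predual

variable {X N : Type*} [NormedAddCommGroup X] [NormedSpace ℂ X] [CStarAlgebra N]

/-- `n` is the weak⋆ limit of `y` along the ultrafilter `U`, the weak⋆ topology being the one
given by the predual `X`. -/
def WLim (e : StrongDual ℂ X ≃ₗᵢ⋆[ℂ] N) {Λ : Type*} (U : Ultrafilter Λ) (y : Λ → N) (n : N) :
    Prop :=
  ∀ x : X, Tendsto (fun l => e.symm (y l) x) U (𝓝 (e.symm n x))

variable {e : StrongDual ℂ X ≃ₗᵢ⋆[ℂ] N} {Λ : Type*} {U : Ultrafilter Λ}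

lemma WLim.unique {y : Λ → N} {m n : N} (hm : WLim e U y m) (hn : WLim e U y n) : m = n := by
  apply e.symm.injective
  ext x
  exact tendsto_nhds_unique (hm x) (hn x)

lemma WLim.congr' {y z : Λ → N} {m : N} (hm : WLim e U y m) (h : ∀ᶠ l in U, y l = z l) :
    WLim e U z m := fun x => (hm x).congr' (h.mono fun l hl => by rw [hl])

lemma WLim.const (c : N) : WLim e U (fun _ => c) c := fun _ => tendsto_const_nhds

lemma WLim.add {y z : Λ → N} {m n : N} (hm : WLim e U y m) (hn : WLim e U z n) :
    WLim e U (fun l => y l + z l) (m + n) := fun x => by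
  simpa using (hm x).add (hn x)

lemma WLim.smul (c : ℂ) {y : Λ → N} {m : N} (hm : WLim e U y m) :
    WLim e U (fun l => c • y l) (c • m) := fun x => by
  simp only [map_smulₛₗ, smul_apply]
  exact (hm x).const_smul _

lemma WLim.rsmul (c : ℝ) {y : Λ → N} {m : N} (hm : WLim e U y m) :
    WLim e U (fun l => c • y l) (c • m) := by
  simpa using hm.smul (c : ℂ)

lemma WLim.neg {y : Λ → N} {m : N} (hm : WLim e U y m) : WLim e U (fun l => - y l) (- m) := by
  simpa using hm.rsmul (-1)

lemma WLim.sub {y z : Λ → N} {m n : N} (hm : WLim e U y m) (hn : WLim e U z n) :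
    WLim e U (fun l => y l - z l) (m - n) := by
  simpa [sub_eq_add_neg] using hm.add hn.neg

lemma WLim.sum {ι : Type*} (s : Finset ι) {y : ι → Λ → N} {m : ι → N}
    (h : ∀ i ∈ s, WLim e U (y i) (m i)) :
    WLim e U (fun l => ∑ i ∈ s, y i l) (∑ i ∈ s, m i) := by
  classical
  induction s using Finset.induction_on with
  | empty => simpa using WLim.const 0
  | insert i s hi ih =>
    simp only [Finset.sum_insert hi]
    exact (h i (by simp)).add (ih fun j hj => h j (by simp [hj]))

lemma WLim.exists (e : StrongDual ℂ X ≃ₗᵢ⋆[ℂ] N) {y : Λ → N} {R : ℝ}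
    (hy : ∀ᶠ l in U, ‖y l‖ ≤ R) : ∃ n, WLim e U y n ∧ ‖n‖ ≤ R := by
  have hK := WeakDual.isCompact_closedBall (𝕜 := ℂ) (E := X) 0 R
  have := hK.ultrafilter_le_nhds (U.map fun l => StrongDual.toWeakDual (e.symm (y l))) (by
    rw [le_principal_iff]
    change ∀ᶠ l in (U : Filter Λ), _
    filter_upwards [hy] with l hl
    simpa using hl)
  obtain ⟨w, hw, hlim⟩ := this
  refine ⟨e (WeakDual.toStrongDual w), fun x => ?_, by simpa using hw⟩
  have h1 : Tendsto (fun l => StrongDual.toWeakDual (e.symm (y l))) U (𝓝 w) := hlim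
  have := ((WeakDual.eval_continuous x).tendsto w).comp h1
  simp only [LinearIsometryEquiv.symm_apply_apply]
  exact this

lemma WLim.norm_le {y : Λ → N} {n : N} (hn : WLim e U y n) {R : ℝ}
    (hy : ∀ᶠ l in U, ‖y l‖ ≤ R) : ‖n‖ ≤ R := by
  obtain ⟨n', h1, h2⟩ := WLim.exists e hy
  rwa [hn.unique h1]

end Predual

section Basics

variable {N : Type*} [CStarAlgebra N]

open Complex in
lemma exists_re_im (a : N) : ∃ h k : N, IsSelfAdjoint h ∧ IsSelfAdjoint k ∧
    a = h + I • k := by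
  refine ⟨realPart a, imaginaryPart a, (realPart a).2, (imaginaryPart a).2, ?_⟩
  exact (realPart_add_I_smul_imaginaryPart a).symm

lemma norm_sq_le_of_re_im {h k : N} (hh : IsSelfAdjoint h) (hk : IsSelfAdjoint k) :
    ‖k‖ ≤ ‖h + Complex.I • k‖ := by
  have : (2 : ℂ) • (Complex.I • k) = (h + Complex.I • k) - star (h + Complex.I • k) := by
    simp [hh.star_eq, hk.star_eq, two_smul]
  have h2 : ‖(2 : ℂ) • (Complex.I • k)‖ ≤ ‖h + Complex.I • k‖ + ‖h + Complex.I • k‖ := by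
    rw [this]
    exact (norm_sub_le _ _).trans (by rw [norm_star])
  rw [norm_smul, norm_smul] at h2
  simp at h2
  linarith

lemma isSelfAdjoint_smul_one (R : ℝ) : IsSelfAdjoint (R • (1 : N)) :=
  (IsSelfAdjoint.all R).smul (IsSelfAdjoint.one N)

lemma norm_add_I_smul {h : N} (hh : IsSelfAdjoint h) {R : ℝ} (hR : ‖h‖ ≤ R) (t : ℝ) :
    ‖h + (Complex.I * t) • (1 : N)‖ ^ 2 ≤ R ^ 2 + t ^ 2 := by
  rw [sq, ← CStarRing.norm_star_mul_self]
  have : star (h + (Complex.I * t) • (1 : N)) * (h + (Complex.I * t) • (1 : N))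
      = h * h + ((t ^ 2 : ℝ) : ℂ) • (1 : N) := by
    simp only [star_add, hh.star_eq, star_smul, star_one, add_mul, mul_add, smul_mul_assoc,
      one_mul, mul_smul_comm, mul_one]
    simp only [star_mul', RCLike.star_def, Complex.conj_I, Complex.conj_ofReal]
    have e1 : (-Complex.I * (t : ℂ)) * (Complex.I * t) = ((t ^ 2 : ℝ) : ℂ) := by
      push_cast; ring_nf; simp
    rw [smul_add, smul_smul, mul_comm (Complex.I * (t:ℂ)), e1, neg_mul, neg_smul]
    abel
  rw [this]
  refine (norm_add_le _ _).trans ?_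
  have h1 : ‖h * h‖ ≤ R ^ 2 := (norm_mul_le _ _).trans (by nlinarith [norm_nonneg h])
  rcases subsingleton_or_nontrivial N with hN | hN
  · rw [Subsingleton.elim (h * h) 0, Subsingleton.elim (_ • (1:N)) 0]; simp; positivity
  · have h2 : ‖((t ^ 2 : ℝ) : ℂ) • (1 : N)‖ = t ^ 2 := by
      rw [norm_smul, norm_one, mul_one, Complex.norm_real]; simp
    linarith

variable [PartialOrder N] [StarOrderedRing N]

/-- Real multiples of the unit are at most the bound on the norm. -/
lemma le_smul_one_of_norm_le {a : N} (ha : IsSelfAdjoint a) {R : ℝ} (h : ‖a‖ ≤ R) :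
    a ≤ R • (1 : N) := by
  refine (ha.le_algebraMap_norm_self).trans ?_
  rw [Algebra.algebraMap_eq_smul_one]
  exact smul_le_smul_of_nonneg_right h zero_le_one

lemma norm_le_of_between {a : N} {R : ℝ} (hR : 0 ≤ R) (h1 : -(R • (1 : N)) ≤ a)
    (h2 : a ≤ R • (1 : N)) : ‖a‖ ≤ R := by
  have hsa : IsSelfAdjoint a := by
    have := IsSelfAdjoint.of_nonneg (sub_nonneg.2 h2)
    have h3 : a = R • (1 : N) - (R • (1 : N) - a) := by abel
    rw [h3]
    exact (isSelfAdjoint_smul_one R).sub this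
  rcases subsingleton_or_nontrivial N with hN | hN
  · simpa [Subsingleton.elim a 0] using hR
  have h1' : algebraMap ℝ N (-R) ≤ a := by
    simpa [Algebra.algebraMap_eq_smul_one] using h1
  have h2' : a ≤ algebraMap ℝ N R := by simpa [Algebra.algebraMap_eq_smul_one] using h2
  have s1 := (algebraMap_le_iff_le_spectrum (R := ℝ) (a := a) (r := -R)).1 h1'
  have s2 := (le_algebraMap_iff_spectrum_le (R := ℝ) (a := a) (r := R)).1 h2'
  rcases CStarAlgebra.norm_or_neg_norm_mem_spectrum (a := a) hsa with h | h
  · exact s2 _ h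
  · linarith [s1 _ h]

/-- A self-adjoint element `k` with `‖k + t‖² ≤ R + t²` for all real `t` vanishes. -/
lemma eq_zero_of_norm_add_smul {k : N} (hk : IsSelfAdjoint k) {R : ℝ}
    (h : ∀ t : ℝ, ‖k + t • (1 : N)‖ ^ 2 ≤ R + t ^ 2) : k = 0 := by
  have key : ∀ j : N, IsSelfAdjoint j → (∀ t : ℝ, ‖j + t • (1 : N)‖ ^ 2 ≤ R + t ^ 2) → j ≤ 0 := by
    intro j hj h
    have hR : 0 ≤ R := by have := h 0; nlinarith [sq_nonneg ‖j + (0:ℝ) • (1 : N)‖]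
    have h1 : ∀ t : ℝ, 0 < t → j ≤ (R / t) • (1 : N) := by
      intro t ht
      have h2 : ‖j + t • (1 : N)‖ ≤ R / t + t := by
        have h3 := h t
        have h4 : 0 ≤ R / t := by positivity
        have h5 : R / t * t = R := by field_simp
        apply le_of_sq_le_sq _ (by positivity)
        nlinarith
      have h6 := le_smul_one_of_norm_le (hj.add (isSelfAdjoint_smul_one t)) h2
      rw [add_smul] at h6
      exact le_of_add_le_add_right h6
    have hlim : Tendsto (fun t : ℝ => (R / t) • (1 : N) - j) atTop (𝓝 ((0 : ℝ) • (1 : N) - j)) :=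
      ((tendsto_const_nhds.div_atTop tendsto_id).smul_const _).sub_const _
    have := CStarAlgebra.isClosed_nonneg.mem_of_tendsto hlim
      ((eventually_gt_atTop 0).mono fun t ht => sub_nonneg.2 (h1 t ht))
    simpa using this
  refine le_antisymm (key k hk h) ?_
  have := key (-k) hk.neg fun t => by
    have := h (-t)
    rwa [← norm_neg, neg_add, ← neg_smul, neg_neg, neg_sq] at this
  simpa using this

end Basics

section Predual

variable {X N : Type*} [NormedAddCommGroup X] [NormedSpace ℂ X]
  [CStarAlgebra N] [PartialOrder N] [StarOrderedRing N]
  {e : StrongDual ℂ X ≃ₗᵢ⋆[ℂ] N} {Λ : Type*} {U : Ultrafilter Λ}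

lemma WLim.isSelfAdjoint {y : Λ → N} {n : N} (hn : WLim e U y n) {R : ℝ}
    (hy : ∀ᶠ l in U, ‖y l‖ ≤ R) (hsa : ∀ᶠ l in U, IsSelfAdjoint (y l)) : IsSelfAdjoint n := by
  obtain ⟨h, k, hh, hk, rfl⟩ := exists_re_im n
  suffices k = 0 by simpa [this] using hh
  refine eq_zero_of_norm_add_smul (R := R ^ 2) hk fun t => ?_
  have h1 : WLim e U (fun l => y l + (Complex.I * t) • (1 : N))
      (h + Complex.I • k + (Complex.I * t) • (1 : N)) := hn.add (WLim.const _)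
  have h2 : ‖h + Complex.I • k + (Complex.I * t) • (1 : N)‖ ≤ √(R ^ 2 + t ^ 2) := by
    apply h1.norm_le
    filter_upwards [hy, hsa] with l h3 h4
    exact Real.le_sqrt_of_sq_le (norm_add_I_smul h4 h3 t)
  have h3 : h + Complex.I • k + (Complex.I * t) • (1 : N) =
      h + Complex.I • (k + t • (1 : N)) := by
    rw [smul_add, add_assoc, mul_smul, Complex.coe_smul]
  have h4 := norm_sq_le_of_re_im hh (hk.add (isSelfAdjoint_smul_one t))
  rw [← h3] at h4
  exact (Real.le_sqrt (norm_nonneg _) (by positivity)).1 (h4.trans h2)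

lemma WLim.nonneg {y : Λ → N} {n : N} (hn : WLim e U y n) {R : ℝ}
    (hy : ∀ᶠ l in U, ‖y l‖ ≤ R) (h0 : ∀ᶠ l in U, 0 ≤ y l) : 0 ≤ n := by
  have hR : 0 ≤ R := by
    obtain ⟨l, hl⟩ := hy.exists
    exact (norm_nonneg _).trans hl
  have hsa := hn.isSelfAdjoint hy (h0.mono fun l hl => IsSelfAdjoint.of_nonneg hl)
  have h1 : ‖R • (1 : N) - n‖ ≤ R := by
    refine ((WLim.const _).sub hn).norm_le ?_
    filter_upwards [hy, h0] with l h2 h3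
    have h4 := le_smul_one_of_norm_le (IsSelfAdjoint.of_nonneg h3) h2
    refine norm_le_of_between hR ?_ (by simpa using h3)
    exact (neg_nonpos.2 (smul_nonneg hR zero_le_one)).trans (sub_nonneg.2 h4)
  have h2 := le_smul_one_of_norm_le
    ((isSelfAdjoint_smul_one R).sub hsa) h1
  simpa using h2

lemma WLim.star {y : Λ → N} {n : N} (hn : WLim e U y n) {R : ℝ}
    (hy : ∀ᶠ l in U, ‖y l‖ ≤ R) : WLim e U (fun l => star (y l)) (star n) := by
  have hy' : ∀ᶠ l in U, ‖Star.star (y l)‖ ≤ R := by simpa using hy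
  obtain ⟨z, hz, -⟩ := WLim.exists e hy'
  have h1 : IsSelfAdjoint (n + z) := (hn.add hz).isSelfAdjoint (R := R + R)
    (by filter_upwards [hy, hy'] with l a b using (norm_add_le _ _).trans (add_le_add a b))
    (Eventually.of_forall fun l => IsSelfAdjoint.add_star_self _)
  have h2 : IsSelfAdjoint (Complex.I • (n - z)) := ((hn.sub hz).smul _).isSelfAdjoint (R := R + R)
    (by
      filter_upwards [hy, hy'] with l a b
      rw [norm_smul, Complex.norm_I, one_mul]
      exact (norm_sub_le _ _).trans (add_le_add a b))
    (Eventually.of_forall fun l => by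
      simp [IsSelfAdjoint, ← smul_neg])
  have h3 : Star.star n + Star.star z = n + z := by simpa using h1.star_eq
  have h4 : Star.star z - Star.star n = n - z := by
    have := h2.star_eq
    simp only [star_smul, star_sub, RCLike.star_def, Complex.conj_I, neg_smul, ← smul_neg,
      neg_sub] at this
    exact smul_right_injective N Complex.I_ne_zero this
  have h5 : Star.star n = z := by
    have h7 : (2 : ℂ) • Star.star n = (2 : ℂ) • z := by
      rw [two_smul, two_smul]
      calc _ = (Star.star n + Star.star z) - (Star.star z - Star.star n) := by abel
        _ = _ := by rw [h3, h4]; abel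
    exact smul_right_injective N (two_ne_zero) h7
  rwa [h5]

end Predual

section Kadison

variable {X N : Type*} [NormedAddCommGroup X] [NormedSpace ℂ X]
  [CStarAlgebra N] [PartialOrder N] [StarOrderedRing N]
  {e : StrongDual ℂ X ≃ₗᵢ⋆[ℂ] N} {Λ : Type*} {U : Ultrafilter Λ}

omit [NormedAddCommGroup X] [NormedSpace ℂ X] in
lemma bernstein_nonneg {h : N} (h0 : 0 ≤ h) (h1 : h ≤ 1) (n ν : ℕ) :
    0 ≤ Polynomial.aeval h (bernsteinPolynomial ℝ n ν) := by
  have h2 : 0 ≤ h ^ ν := CStarAlgebra.pow_nonneg h0 ν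
  have h3 : 0 ≤ (1 - h) ^ (n - ν) := CStarAlgebra.pow_nonneg (sub_nonneg.2 h1) _
  have hc : Commute (h ^ ν) ((1 - h) ^ (n - ν)) :=
    ((Commute.one_right h).sub_right (Commute.refl h)).pow_pow _ _
  have h4 : 0 ≤ h ^ ν * (1 - h) ^ (n - ν) := hc.mul_nonneg h2 h3
  have : Polynomial.aeval h (bernsteinPolynomial ℝ n ν)
      = (n.choose ν) • (h ^ ν * (1 - h) ^ (n - ν)) := by
    simp [bernsteinPolynomial, mul_assoc, nsmul_eq_mul]
  rw [this]
  exact nsmul_nonneg h4 _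

lemma norm_le_one_of_mem {a : N} (h0 : 0 ≤ a) (h1 : a ≤ 1) : ‖a‖ ≤ 1 :=
  norm_le_of_between zero_le_one (by simpa using (neg_nonpos.2 zero_le_one).trans h0) (by simpa)

lemma kadison_unit_interval {y : Λ → N} {T S : N} (hT : WLim e U y T)
    (hS : WLim e U (fun l => y l * y l) S) (h0 : ∀ᶠ l in U, 0 ≤ y l) (h1 : ∀ᶠ l in U, y l ≤ 1) :
    T * T ≤ S := by
  have key : ∀ n : ℕ, ((n : ℝ) ^ 2) • (T * T) ≤ ((n : ℝ) * (n - 1)) • S + (n : ℝ) • T := by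
    intro n
    set b : ℕ → Λ → N := fun ν l => Polynomial.aeval (y l) (bernsteinPolynomial ℝ n ν) with hb
    have hsum : ∀ l, ∑ ν ∈ Finset.range (n + 1), b ν l = 1 := fun l => by
      rw [← map_sum, bernsteinPolynomial.sum, map_one]
    have hsum1 : ∀ l, ∑ ν ∈ Finset.range (n + 1), (ν : ℝ) • b ν l = (n : ℝ) • y l := fun l => by
      have := congrArg (Polynomial.aeval (y l)) (bernsteinPolynomial.sum_smul ℝ n)
      simpa [map_sum, Nat.cast_smul_eq_nsmul] using this
    have hsum2 : ∀ l, ∑ ν ∈ Finset.range (n + 1), ((ν : ℝ) ^ 2) • b ν l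
        = ((n : ℝ) * (n - 1)) • (y l * y l) + (n : ℝ) • y l := fun l => by
      have := congrArg (Polynomial.aeval (y l)) (bernsteinPolynomial.sum_mul_smul ℝ n)
      rw [← hsum1 l]
      have hcast : ∀ k : ℕ, ((k * (k - 1) : ℕ) : ℝ) = (k : ℝ) * (k - 1) := by
        intro k; cases k <;> simp
      have h2 : ∑ ν ∈ Finset.range (n + 1), ((ν : ℝ) * (ν - 1)) • b ν l =
          ((n : ℝ) * (n - 1)) • (y l * y l) := by
        simp only [← hcast, Nat.cast_smul_eq_nsmul]
        rw [map_sum] at this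
        simp only [map_nsmul, map_pow, Polynomial.aeval_X] at this
        rw [this, sq]
      rw [← h2, ← Finset.sum_add_distrib]
      refine Finset.sum_congr rfl fun ν _ => ?_
      rw [← add_smul]
      congr 1; ring
    have hb0 : ∀ ν, ∀ᶠ l in U, 0 ≤ b ν l := fun ν => by
      filter_upwards [h0, h1] with l a c using bernstein_nonneg a c n ν
    have hb1 : ∀ ν ∈ Finset.range (n + 1), ∀ᶠ l in U, ‖b ν l‖ ≤ 1 := fun ν hν => by
      filter_upwards [h0, h1] with l a c
      refine norm_le_one_of_mem (bernstein_nonneg a c n ν) ?_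
      rw [← hsum l]
      exact Finset.single_le_sum (f := fun ν => b ν l) (fun i _ => bernstein_nonneg a c n i) hν
    have hex : ∀ ν, ∃ t, ν ∈ Finset.range (n + 1) → WLim e U (b ν) t ∧ 0 ≤ t := fun ν => by
      by_cases hν : ν ∈ Finset.range (n + 1)
      · obtain ⟨t, ht, -⟩ := WLim.exists e (hb1 ν hν)
        exact ⟨t, fun _ => ⟨ht, ht.nonneg (hb1 ν hν) (hb0 ν)⟩⟩
      · exact ⟨0, fun h => absurd h hν⟩
    choose t ht using hex
    have s0 : ∑ ν ∈ Finset.range (n + 1), t ν = 1 := by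
      refine (WLim.sum (e := e) (U := U) _ fun ν hν => (ht ν hν).1).unique ?_
      simp only [hsum]; exact WLim.const 1
    have s1 : ∑ ν ∈ Finset.range (n + 1), (ν : ℝ) • t ν = (n : ℝ) • T := by
      refine (WLim.sum (e := e) (U := U) _ fun ν hν => (ht ν hν).1.rsmul _).unique ?_
      simp only [hsum1]; exact hT.rsmul _
    have s2 : ∑ ν ∈ Finset.range (n + 1), ((ν : ℝ) ^ 2) • t ν
        = ((n : ℝ) * (n - 1)) • S + (n : ℝ) • T := by
      refine (WLim.sum (e := e) (U := U) _ fun ν hν => (ht ν hν).1.rsmul _).unique ?_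
      simp only [hsum2]; exact (hS.rsmul _).add (hT.rsmul _)
    have hTsa : IsSelfAdjoint T := hT.isSelfAdjoint (R := 1)
      (by filter_upwards [h0, h1] with l a c using norm_le_one_of_mem a c)
      (h0.mono fun l hl => IsSelfAdjoint.of_nonneg hl)
    have hpos : 0 ≤ ∑ ν ∈ Finset.range (n + 1),
        ((ν : ℝ) • (1 : N) - (n : ℝ) • T) * t ν * ((ν : ℝ) • (1 : N) - (n : ℝ) • T) := by
      refine Finset.sum_nonneg fun ν hν => ?_
      have hsa : IsSelfAdjoint ((ν : ℝ) • (1 : N) - (n : ℝ) • T) :=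
        (isSelfAdjoint_smul_one _).sub ((IsSelfAdjoint.all (n : ℝ)).smul hTsa)
      exact hsa.conjugate_nonneg (ht ν hν).2
    have hexp : ∑ ν ∈ Finset.range (n + 1),
        ((ν : ℝ) • (1 : N) - (n : ℝ) • T) * t ν * ((ν : ℝ) • (1 : N) - (n : ℝ) • T)
        = (((n : ℝ) * (n - 1)) • S + (n : ℝ) • T) - ((n : ℝ) ^ 2) • (T * T) := by
      calc _ = ∑ ν ∈ Finset.range (n + 1), (((ν : ℝ) ^ 2) • t ν - (n : ℝ) • (T * ((ν : ℝ) • t ν))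
            - (n : ℝ) • (((ν : ℝ) • t ν) * T) + ((n : ℝ) ^ 2) • (T * t ν * T)) := by
            refine Finset.sum_congr rfl fun ν _ => ?_
            simp only [sub_mul, mul_sub, smul_mul_assoc, mul_smul_comm, one_mul, mul_one,
              smul_smul, sq]
            module
        _ = _ := by
            rw [Finset.sum_add_distrib, Finset.sum_sub_distrib, Finset.sum_sub_distrib,
              ← Finset.smul_sum, ← Finset.smul_sum, ← Finset.smul_sum, ← Finset.mul_sum,
              ← Finset.sum_mul, ← Finset.sum_mul, ← Finset.mul_sum, s0, s1, s2]
            simp only [mul_one, smul_mul_assoc, mul_smul_comm, smul_smul, sq]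
            abel
    rw [hexp] at hpos
    exact sub_nonneg.1 hpos
  have hlim : Tendsto (fun n : ℕ => S + (1 / ((n : ℝ) + 1)) • (T - S) - T * T) atTop
      (𝓝 (S + (0 : ℝ) • (T - S) - T * T)) :=
    ((tendsto_one_div_add_atTop_nhds_zero_nat.smul_const _).const_add _).sub_const _
  have := CStarAlgebra.isClosed_nonneg.mem_of_tendsto hlim (Eventually.of_forall fun n => by
    have h2 := key (n + 1)
    have hpos : (0 : ℝ) < ((n : ℝ) + 1) ^ 2 := by positivity
    have h3 : 0 ≤ (((n : ℝ) + 1) ^ 2)⁻¹ • ((((n : ℝ) + 1) * n) • S + ((n : ℝ) + 1) • T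
        - (((n : ℝ) + 1) ^ 2) • (T * T)) := by
      refine smul_nonneg (by positivity) (sub_nonneg.2 ?_)
      push_cast at h2
      simpa using h2
    change 0 ≤ S + (1 / ((n : ℝ) + 1)) • (T - S) - T * T
    refine h3.trans_eq ?_
    match_scalars
    · field_simp; ring
    · field_simp
    · field_simp)
  simpa using this

/-- **Kadison's inequality** for the positive map given by a weak⋆ limit. -/
lemma kadison {y : Λ → N} {T S : N} {R : ℝ} (hR : ∀ᶠ l in U, ‖y l‖ ≤ R)
    (hsa : ∀ᶠ l in U, IsSelfAdjoint (y l)) (hT : WLim e U y T)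
    (hS : WLim e U (fun l => y l * y l) S) : T * T ≤ S := by
  obtain ⟨r, hr, hRr⟩ : ∃ r : ℝ, 0 < r ∧ R ≤ r := ⟨max R 1, by positivity, le_max_left _ _⟩
  have expand : ∀ z w : N, w = (4 * r ^ 2)⁻¹ • (z * z + (2 * r) • z + (r ^ 2) • (1 : N)) ↔
      w = ((2 * r)⁻¹ • (z + r • (1 : N))) * ((2 * r)⁻¹ • (z + r • (1 : N))) := by
    intro z w
    have : (4 * r ^ 2)⁻¹ • (z * z + (2 * r) • z + (r ^ 2) • (1 : N)) =
        ((2 * r)⁻¹ • (z + r • (1 : N))) * ((2 * r)⁻¹ • (z + r • (1 : N))) := by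
      simp only [smul_mul_assoc, mul_smul_comm, smul_smul, add_mul, mul_add, one_mul, mul_one]
      match_scalars <;> field_simp <;> norm_num
    rw [this]
  have h1 : WLim e U (fun l => (2 * r)⁻¹ • (y l + r • (1 : N))) ((2 * r)⁻¹ • (T + r • (1 : N))) :=
    (hT.add (WLim.const _)).rsmul _
  have h2 : WLim e U (fun l => ((2 * r)⁻¹ • (y l + r • (1 : N))) * ((2 * r)⁻¹ • (y l + r • (1 : N))))
      ((4 * r ^ 2)⁻¹ • (S + (2 * r) • T + (r ^ 2) • (1 : N))) := by
    refine (((hS.add (hT.rsmul _)).add (WLim.const _)).rsmul _).congr'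
      (Eventually.of_forall fun l => (expand _ _).1 rfl)
  have h3 := kadison_unit_interval h1 h2
    (by
      filter_upwards [hR, hsa] with l a c
      have := le_smul_one_of_norm_le c.neg (R := r) (by rw [norm_neg]; exact a.trans hRr)
      exact smul_nonneg (by positivity) (neg_le_iff_add_nonneg'.1 this))
    (by
      filter_upwards [hR, hsa] with l a c
      have := le_smul_one_of_norm_le c (a.trans hRr)
      calc (2 * r)⁻¹ • (y l + r • (1 : N)) ≤ (2 * r)⁻¹ • (r • (1 : N) + r • (1 : N)) :=
            smul_le_smul_of_nonneg_left (by gcongr) (by positivity)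
        _ = 1 := by
          rw [← add_smul, smul_smul, ← two_mul, inv_mul_cancel₀ (by positivity), one_smul])
  rw [← (expand _ _).1 rfl] at h3
  have h4 : (4 * r ^ 2) • ((4 * r ^ 2)⁻¹ • (T * T + (2 * r) • T + (r ^ 2) • (1 : N))) ≤
      (4 * r ^ 2) • ((4 * r ^ 2)⁻¹ • (S + (2 * r) • T + (r ^ 2) • (1 : N))) :=
    smul_le_smul_of_nonneg_left h3 (by positivity)
  rw [smul_inv_smul₀ (by positivity), smul_inv_smul₀ (by positivity)] at h4
  simpa using h4

lemma eq_zero_of_add_smul_nonneg {A K : N} (h : ∀ t : ℝ, 0 ≤ A + t • K) : K = 0 := by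
  have key : ∀ K : N, (∀ t : ℝ, 0 ≤ A + t • K) → 0 ≤ K := by
    intro K h
    have hlim : Tendsto (fun n : ℕ => (1 / ((n : ℝ) + 1)) • A + K) atTop
        (𝓝 ((0 : ℝ) • A + K)) :=
      (tendsto_one_div_add_atTop_nhds_zero_nat.smul_const _).add_const _
    have := CStarAlgebra.isClosed_nonneg.mem_of_tendsto hlim (Eventually.of_forall fun n => by
      have h2 : 0 ≤ (1 / ((n : ℝ) + 1)) • (A + ((n : ℝ) + 1) • K) :=
        smul_nonneg (by positivity) (h _)
      rwa [smul_add, smul_smul, one_div, inv_mul_cancel₀ (by positivity), one_smul,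
        ← one_div] at h2)
    simpa using this
  refine le_antisymm ?_ (key K h)
  have := key (-K) fun t => by simpa using h (-t)
  simpa using this

lemma WLim.jordan_of_isSelfAdjoint {y : Λ → N} {T c : N} {R : ℝ} (hR : ∀ᶠ l in U, ‖y l‖ ≤ R)
    (hsa : ∀ᶠ l in U, IsSelfAdjoint (y l)) (hT : WLim e U y T) (hc : IsSelfAdjoint c) :
    WLim e U (fun l => c * y l + y l * c) (c * T + T * c) := by
  have hR0 : 0 ≤ R := by
    obtain ⟨l, hl⟩ := hR.exists
    exact (norm_nonneg _).trans hl
  obtain ⟨S, hS, -⟩ := WLim.exists (U := U) (y := fun l => y l * y l) (R := R * R) e (by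
    filter_upwards [hR] with l hl
    exact (norm_mul_le _ _).trans (mul_le_mul hl hl (norm_nonneg _) hR0))
  obtain ⟨J, hJ, -⟩ := WLim.exists (U := U) (y := fun l => c * y l + y l * c)
    (R := ‖c‖ * R + R * ‖c‖) e (by
    filter_upwards [hR] with l hl
    refine (norm_add_le _ _).trans (add_le_add ((norm_mul_le _ _).trans ?_)
      ((norm_mul_le _ _).trans ?_)) <;> gcongr)
  have key : ∀ t : ℝ, 0 ≤ (S - T * T) + t • (J - (c * T + T * c)) := by
    intro t
    have expand : ∀ z : N, (z + t • c) * (z + t • c) = z * z + t • (c * z + z * c)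
        + (t ^ 2) • (c * c) := by
      intro z
      simp only [add_mul, mul_add, smul_mul_assoc, mul_smul_comm, smul_smul, smul_add, sq]
      abel
    have h1 : WLim e U (fun l => y l + t • c) (T + t • c) := hT.add (WLim.const _)
    have h2 : WLim e U (fun l => (y l + t • c) * (y l + t • c))
        (S + t • J + (t ^ 2) • (c * c)) := by
      simp only [expand]
      exact (hS.add (hJ.rsmul _)).add (WLim.const _)
    have h3 := kadison (R := R + ‖t • c‖)
      (by filter_upwards [hR] with l hl using (norm_add_le _ _).trans (by gcongr))
      (by filter_upwards [hsa] with l hl using hl.add ((IsSelfAdjoint.all t).smul hc)) h1 h2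
    rw [expand, add_le_add_iff_right] at h3
    have h4 := sub_nonneg.2 h3
    rw [smul_sub]
    convert h4 using 1
    abel
  have := eq_zero_of_add_smul_nonneg key
  rwa [sub_eq_zero.1 this] at hJ

/-- Weak⋆ limits are compatible with self-adjoint Jordan multiplication. -/
lemma WLim.jordan {y : Λ → N} {T c : N} {R : ℝ} (hR : ∀ᶠ l in U, ‖y l‖ ≤ R)
    (hT : WLim e U y T) (hc : IsSelfAdjoint c) :
    WLim e U (fun l => c * y l + y l * c) (c * T + T * c) := by
  have hs := hT.star hR
  have hR' : ∀ᶠ l in U, ‖Star.star (y l)‖ ≤ R := by simpa using hR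
  have h1 := WLim.jordan_of_isSelfAdjoint (R := R + R)
    (by filter_upwards [hR, hR'] with l a b using (norm_add_le _ _).trans (add_le_add a b))
    (Eventually.of_forall fun l => IsSelfAdjoint.add_star_self (y l)) (hT.add hs) hc
  have h2 := WLim.jordan_of_isSelfAdjoint (y := fun l => Complex.I • (y l - Star.star (y l)))
    (R := R + R)
    (by
      filter_upwards [hR, hR'] with l a b
      rw [norm_smul, Complex.norm_I, one_mul]
      exact (norm_sub_le _ _).trans (add_le_add a b))
    (Eventually.of_forall fun l => by simp [IsSelfAdjoint, ← smul_neg])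
    ((hT.sub hs).smul Complex.I) hc
  have h3 := (h1.sub (h2.smul Complex.I)).rsmul (1 / 2)
  have expand : ∀ z w : N, (1 / 2 : ℝ) • ((c * (z + w) + (z + w) * c) -
      Complex.I • (c * (Complex.I • (z - w)) + (Complex.I • (z - w)) * c)) = c * z + z * c := by
    intro z w
    simp only [mul_smul_comm, smul_mul_assoc, ← smul_add, smul_smul, Complex.I_mul_I, neg_smul,
      one_smul, sub_neg_eq_add]
    have : (c * (z + w) + (z + w) * c) + (c * (z - w) + (z - w) * c)
        = (2 : ℝ) • (c * z + z * c) := by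
      rw [two_smul]; noncomm_ring
    rw [this, smul_smul]; norm_num
  simpa only [expand] using h3

/-- Weak⋆ limits are compatible with compressions by self-adjoint elements. -/
lemma WLim.conj {y : Λ → N} {T c : N} {R : ℝ} (hR : ∀ᶠ l in U, ‖y l‖ ≤ R)
    (hT : WLim e U y T) (hc : IsSelfAdjoint c) :
    WLim e U (fun l => c * y l * c) (c * T * c) := by
  have h1 := hT.jordan hR hc
  have h2 := h1.jordan (R := ‖c‖ * R + R * ‖c‖) (by
    filter_upwards [hR] with l hl
    refine (norm_add_le _ _).trans (add_le_add ((norm_mul_le _ _).trans ?_)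
      ((norm_mul_le _ _).trans ?_)) <;> gcongr) hc
  have h3 := hT.jordan hR (c := c * c) (by simp [IsSelfAdjoint, hc.star_eq])
  have expand : ∀ z : N, (1 / 2 : ℝ) • ((c * (c * z + z * c) + (c * z + z * c) * c)
      - (c * c * z + z * (c * c))) = c * z * c := by
    intro z
    have : (c * (c * z + z * c) + (c * z + z * c) * c) - (c * c * z + z * (c * c))
        = (2 : ℝ) • (c * z * c) := by
      rw [two_smul]; noncomm_ring
    rw [this, smul_smul]; norm_num
  simpa only [expand] using (h2.sub h3).rsmul (1 / 2)

end Kadison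

section Separation

variable {V : Type u} [NormedAddCommGroup V] [NormedSpace ℝ V]

/-- Functionals on the space of null families over a discrete set are given by summable
families. -/
lemma exists_summable_of_dual_zeroAtInfty {J : Type*} [TopologicalSpace J] [DiscreteTopology J]
    (L : ZeroAtInftyContinuousMap J ℝ →L[ℝ] ℝ) :
    ∃ a : J → ℝ, Summable (fun j => |a j|) ∧ ∀ f, HasSum (fun j => a j * f j) (L f) := by
  classical
  have hz : ∀ (s : Finset J) (g : J → ℝ), ∃ f : ZeroAtInftyContinuousMap J ℝ,
      ∀ j, f j = if j ∈ s then g j else 0 := by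
    intro s g
    refine ⟨⟨⟨fun j => if j ∈ s then g j else 0, continuous_of_discreteTopology⟩, ?_⟩,
      fun j => rfl⟩
    rw [cocompact_eq_cofinite]
    refine tendsto_const_nhds.congr' ?_
    rw [EventuallyEq, eventually_cofinite]
    refine s.finite_toSet.subset fun j hj => ?_
    by_contra h
    exact hj (by simp only [Finset.mem_coe] at h; simp [h])
  have hnorm : ∀ (f : ZeroAtInftyContinuousMap J ℝ) (c : ℝ), 0 ≤ c → (∀ j, |f j| ≤ c) → ‖f‖ ≤ c := by
    intro f c hc h
    rw [← ZeroAtInftyContinuousMap.norm_toBCF_eq_norm]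
    exact (BoundedContinuousFunction.norm_le hc).2 h
  choose d hd using fun j => hz {j} 1
  set a : J → ℝ := fun j => L (d j) with ha
  have hsum : ∀ (s : Finset J) (g : J → ℝ) (f : ZeroAtInftyContinuousMap J ℝ),
      (∀ j, f j = if j ∈ s then g j else 0) → L f = ∑ j ∈ s, a j * g j := by
    intro s g f hf
    have : f = ∑ j ∈ s, g j • d j := by
      ext i
      have h1 : (∑ j ∈ s, g j • d j) i = ∑ j ∈ s, g j * d j i := by
        have := map_sum (⟨⟨fun f => f i, rfl⟩, fun _ _ => rfl⟩ : ZeroAtInftyContinuousMap J ℝ →+ ℝ)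
          (fun j => g j • d j) s
        exact this
      rw [h1, hf]
      simp [hd]
    rw [this, map_sum]
    simp [ha, mul_comm]
  refine ⟨a, ?_, fun f => ?_⟩
  · refine summable_of_sum_le (c := ‖L‖) (fun j => abs_nonneg _) fun s => ?_
    obtain ⟨f, hf⟩ := hz s fun j => SignType.sign (a j)
    have h1 := hsum s _ f hf
    have h2 : ‖f‖ ≤ 1 := hnorm f 1 zero_le_one fun j => by
      rw [hf]
      split_ifs
      · rcases lt_trichotomy (a j) 0 with h | h | h <;> simp [h]
      · simp
    have h3 : L f = ∑ j ∈ s, |a j| := by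
      rw [h1]; exact Finset.sum_congr rfl fun j _ => by rw [mul_comm, sign_mul_self]
    rw [← h3]
    calc L f ≤ ‖L f‖ := Real.le_norm_self _
      _ ≤ ‖L‖ * ‖f‖ := L.le_opNorm f
      _ ≤ ‖L‖ * 1 := by gcongr
      _ = ‖L‖ := mul_one _
  · rw [HasSum, SummationFilter.unconditional_filter, Metric.tendsto_nhds]
    intro ε hε
    have hf0 : Tendsto f cofinite (𝓝 0) := by
      have := f.zero_at_infty'
      rwa [cocompact_eq_cofinite] at this
    set δ : ℝ := ε / (2 * (‖L‖ + 1)) with hδ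
    have hδ0 : 0 < δ := by positivity
    have hfin := (Metric.tendsto_nhds.1 hf0) δ hδ0
    rw [eventually_cofinite] at hfin
    filter_upwards [eventually_ge_atTop hfin.toFinset] with s hs
    obtain ⟨g, hg⟩ := hz s f
    have h1 := hsum s f g hg
    rw [← h1, dist_comm, dist_eq_norm, ← map_sub]
    have h2 : ‖f - g‖ ≤ δ := hnorm _ _ hδ0.le fun j => by
      change |f j - g j| ≤ δ
      rw [hg]
      split_ifs with h
      · simpa using hδ0.le
      · have : j ∉ hfin.toFinset := fun h' => h (hs h')
        simp at this
        simpa using this.le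
    calc ‖L (f - g)‖ ≤ ‖L‖ * ‖f - g‖ := L.le_opNorm _
      _ ≤ ‖L‖ * δ := by gcongr
      _ < (‖L‖ + 1) * (2 * δ) := by nlinarith [norm_nonneg L]
      _ = ε := by rw [hδ]; field_simp

lemma exists_finset_enlarge {Ω : Set (V →ₗ[ℝ] ℝ)} {C : Set V}
    (hnorming : ∀ (y : V) (r : ℝ), 0 ≤ r → (∀ ω ∈ Ω, |ω y| ≤ r) → ‖y‖ ≤ r)
    (hcomp : ∀ (R : ℝ) (U : Ultrafilter V), (∀ᶠ z in (U : Filter V), z ∈ C ∧ ‖z‖ ≤ R) →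
      ∃ y ∈ C, ∀ ω ∈ Ω, Tendsto ω U (𝓝 (ω y)))
    (k : ℕ) (G : Finset ((V →ₗ[ℝ] ℝ) × ℕ)) (hGΩ : ∀ p ∈ G, p.1 ∈ Ω)
    (hG : ∀ y ∈ C, ‖y‖ ≤ k + 1 → ∃ p ∈ G, (p.2 + 1 : ℝ) < |p.1 y|) :
    ∃ F : Finset (V →ₗ[ℝ] ℝ), (∀ ω ∈ F, ω ∈ Ω) ∧
      ∀ y ∈ C, ‖y‖ ≤ k + 2 →
        (∃ p ∈ G, (p.2 + 1 : ℝ) < |p.1 y|) ∨ ∃ ω ∈ F, (k + 1 : ℝ) < |ω y| := by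
  classical
  by_contra! hcon
  have h1 : ∀ F : Finset Ω, ∃ y ∈ C, ‖y‖ ≤ k + 2 ∧ (∀ p ∈ G, |p.1 y| ≤ p.2 + 1) ∧
      ∀ ω ∈ F, |ω.1 y| ≤ k + 1 := by
    intro F
    obtain ⟨y, h1, h2, h3, h4⟩ := hcon (F.map (Function.Embedding.subtype _)) (by
      intro ω hω
      obtain ⟨ω, -, rfl⟩ := Finset.mem_map.1 hω
      exact ω.2)
    exact ⟨y, h1, h2, h3, fun ω hω => h4 ω (by simpa using hω)⟩
  choose Y hYC hYn hYG hYF using h1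
  set U := Ultrafilter.of (atTop : Filter (Finset Ω)) with hU
  obtain ⟨y, hyC, hlim⟩ := hcomp (k + 2) (U.map Y) (by
    rw [Ultrafilter.coe_map, eventually_map]
    exact Eventually.of_forall fun F => ⟨hYC F, hYn F⟩)
  have hlim' : ∀ ω ∈ Ω, Tendsto (fun F => ω (Y F)) U (𝓝 (ω y)) := hlim
  obtain ⟨p, hp, hlt⟩ := hG y hyC (hnorming y (k + 1) (by positivity) fun ω hω => by
    refine le_of_tendsto (hlim' ω hω).abs ?_
    have := (eventually_ge_atTop ({⟨ω, hω⟩} : Finset Ω)).filter_mono (Ultrafilter.of_le _)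
    filter_upwards [this] with F hF
    exact hYF F ⟨ω, hω⟩ (hF (by simp)))
  refine hlt.not_ge (le_of_tendsto (hlim' p.1 (hGΩ p hp)).abs ?_)
  exact Eventually.of_forall fun F => hYG F p hp

/-- A **Krein–Smulian** type separation theorem: a convex set whose bounded parts are
compact for a norming set of functionals and which misses the unit ball is separated from `0`
by an absolutely convergent combination of these functionals. -/
theorem exists_summable_separation {Ω : Set (V →ₗ[ℝ] ℝ)} {C : Set V} (hC : Convex ℝ C)
    (hΩ : ∀ ω ∈ Ω, ∀ y, |ω y| ≤ ‖y‖)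
    (hnorming : ∀ (y : V) (r : ℝ), 0 ≤ r → (∀ ω ∈ Ω, |ω y| ≤ r) → ‖y‖ ≤ r)
    (hcomp : ∀ (R : ℝ) (U : Ultrafilter V), (∀ᶠ z in (U : Filter V), z ∈ C ∧ ‖z‖ ≤ R) →
      ∃ y ∈ C, ∀ ω ∈ Ω, Tendsto ω U (𝓝 (ω y)))
    (hball : ∀ y ∈ C, 1 < ‖y‖) :
    ∃ (J : Type u) (w : J → (V →ₗ[ℝ] ℝ)) (a : J → ℝ), (∀ j, w j ∈ Ω) ∧
      Summable (fun j => |a j|) ∧ ∀ c ∈ C, 1 ≤ ∑' j, a j * w j c := by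
  classical
  let Inv : ℕ → Finset ((V →ₗ[ℝ] ℝ) × ℕ) → Prop := fun k G =>
    (∀ p ∈ G, p.1 ∈ Ω) ∧ ∀ y ∈ C, ‖y‖ ≤ k + 1 → ∃ p ∈ G, (p.2 + 1 : ℝ) < |p.1 y|
  have hstep : ∀ k G, ∃ F : Finset (V →ₗ[ℝ] ℝ), Inv k G →
      (∀ ω ∈ F, ω ∈ Ω) ∧ Inv (k + 1) (G ∪ F ×ˢ {k}) := by
    intro k G
    by_cases hG : Inv k G
    · obtain ⟨F, hF, h⟩ := exists_finset_enlarge hnorming hcomp k G hG.1 hG.2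
      refine ⟨F, fun _ => ⟨hF, ?_, fun y hy hyk => ?_⟩⟩
      · intro p hp
        rcases Finset.mem_union.1 hp with hp | hp
        · exact hG.1 p hp
        · exact hF _ (Finset.mem_product.1 hp).1
      · push_cast at hyk
        rcases h y hy (by linarith) with ⟨p, hp, h⟩ | ⟨ω, hω, h⟩
        · exact ⟨p, Finset.mem_union_left _ hp, h⟩
        · exact ⟨(ω, k), by simp [hω], h⟩
    · exact ⟨∅, fun h => absurd h hG⟩
  choose st hst using hstep
  let G : ℕ → Finset ((V →ₗ[ℝ] ℝ) × ℕ) := fun k => Nat.rec ∅ (fun k G => G ∪ st k G ×ˢ {k}) k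
  have hG : ∀ k, Inv k (G k) := by
    intro k
    induction k with
    | zero =>
      refine ⟨by simp [G], fun y hy hy1 => ?_⟩
      have := hball y hy
      norm_num at hy1
      linarith
    | succ k ih => exact (hst k _ ih).2
  let F : ℕ → Finset (V →ₗ[ℝ] ℝ) := fun k => st k (G k)
  have hFΩ : ∀ k, ∀ ω ∈ F k, ω ∈ Ω := fun k => (hst k _ (hG k)).1
  have hGF : ∀ k, ∀ p ∈ G k, p.1 ∈ F p.2 := by
    intro k
    induction k with
    | zero => simp [G]
    | succ k ih =>
      intro p hp
      have hp' : p ∈ G k ∪ F k ×ˢ {k} := hp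
      rcases Finset.mem_union.1 hp' with hp | hp
      · exact ih p hp
      · have := Finset.mem_product.1 hp
        have h2 : p.2 = k := by simpa using this.2
        rw [h2]; exact this.1
  let J : Type u := Σ i : ℕ, F i
  let _ : TopologicalSpace J := ⊥
  have : DiscreteTopology J := ⟨rfl⟩
  have hS : ∀ y : V, ∃ f : ZeroAtInftyContinuousMap J ℝ,
      ∀ j : J, f j = (j.2.1 y) / (j.1 + 1) := by
    intro y
    refine ⟨⟨⟨fun j : J => (j.2.1 y) / (j.1 + 1), continuous_of_discreteTopology⟩, ?_⟩,
      fun j => rfl⟩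
    rw [cocompact_eq_cofinite, Metric.tendsto_nhds]
    intro ε hε
    rw [eventually_cofinite]
    obtain ⟨n, hn⟩ := exists_nat_gt (‖y‖ / ε)
    have hfin : (⋃ i ∈ Set.Iio n, Set.range fun ω : F i => (⟨i, ω⟩ : J)).Finite :=
      (Set.finite_Iio n).biUnion fun i _ => Set.finite_range _
    refine hfin.subset fun j hj => ?_
    obtain ⟨i, ω⟩ := j
    simp only [Set.mem_iUnion]
    refine ⟨i, ?_, ω, rfl⟩
    by_contra hin
    simp only [Set.mem_Iio, not_lt] at hin
    apply hj
    have h1 := hΩ ω.1 (hFΩ i _ ω.2) y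
    have h2 : (n : ℝ) ≤ i := by exact_mod_cast hin
    rw [div_lt_iff₀ hε] at hn
    change dist (ω.1 y / ((i : ℝ) + 1)) 0 < ε
    rw [dist_zero_right, norm_div, Real.norm_eq_abs, Real.norm_of_nonneg (by positivity),
      div_lt_iff₀ (by positivity)]
    nlinarith
  choose S hSval using hS
  have hlin : ∀ (s t : ℝ) (y z : V), S (s • y + t • z) = s • S y + t • S z := by
    intro s t y z
    ext j
    simp only [ZeroAtInftyContinuousMap.coe_add, ZeroAtInftyContinuousMap.coe_smul, Pi.add_apply,
      Pi.smul_apply, hSval, map_add, map_smul, smul_eq_mul]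
    ring
  have hconv : Convex ℝ (S '' C) := by
    rintro _ ⟨y, hy, rfl⟩ _ ⟨z, hz, rfl⟩ s t hs ht hst
    exact ⟨_, hC hy hz hs ht hst, hlin s t y z⟩
  have hdisj : Disjoint (Metric.ball (0 : ZeroAtInftyContinuousMap J ℝ) 1) (S '' C) := by
    rw [Set.disjoint_right]
    rintro _ ⟨y, hy, rfl⟩ hball
    obtain ⟨k, hk⟩ := exists_nat_ge ‖y‖
    obtain ⟨p, hp, hlt⟩ := (hG k).2 y hy (by linarith)
    rw [mem_ball_zero_iff, ← ZeroAtInftyContinuousMap.norm_toBCF_eq_norm] at hball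
    have h1 := ((S y).toBCF.norm_coe_le_norm (⟨p.2, p.1, hGF k p hp⟩ : J)).trans_lt hball
    change ‖S y _‖ < 1 at h1
    rw [hSval, norm_div, Real.norm_eq_abs, Real.norm_of_nonneg (by positivity),
      div_lt_iff₀ (by positivity)] at h1
    linarith
  obtain ⟨L, u, hLu, huL⟩ := geometric_hahn_banach_open (convex_ball _ _) Metric.isOpen_ball
    hconv hdisj
  have hu : 0 < u := by simpa using hLu 0 (by simp)
  obtain ⟨a, ha, hLa⟩ := exists_summable_of_dual_zeroAtInfty L
  have hle : ∀ j : J, |u⁻¹ * a j / (j.1 + 1)| ≤ u⁻¹ * |a j| := by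
    intro j
    rw [abs_div, abs_mul, abs_of_pos (inv_pos.2 hu), abs_of_pos (a := (j.1 + 1 : ℝ)) (by positivity)]
    exact div_le_self (by positivity) (by simp)
  refine ⟨J, fun j => j.2.1, fun j => u⁻¹ * a j / (j.1 + 1), fun j => hFΩ _ _ j.2.2,
    Summable.of_nonneg_of_le (fun _ => abs_nonneg _) hle (ha.mul_left _), fun c hc => ?_⟩
  have h1 := (hLa (S c)).mul_left u⁻¹
  have h2 : (fun j : J => u⁻¹ * (a j * S c j)) = fun j : J => u⁻¹ * a j / (j.1 + 1) * j.2.1 c := by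
    ext j
    rw [hSval]; ring
  rw [h2] at h1
  rw [h1.tsum_eq]
  have := huL _ ⟨c, hc, rfl⟩
  rw [inv_mul_eq_div, one_le_div hu]
  exact this

end Separation

section WCont

variable {X N : Type*} [NormedAddCommGroup X] [NormedSpace ℂ X] [CStarAlgebra N]

/-- `g` is weak⋆ continuous on bounded sets. -/
def WCont (e : StrongDual ℂ X ≃ₗᵢ⋆[ℂ] N) (g : N → ℂ) : Prop :=
  ∀ (U : Ultrafilter N) (n : N) (R : ℝ), (∀ᶠ z in (U : Filter N), ‖z‖ ≤ R) → WLim e U id n →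
    Tendsto g U (𝓝 (g n))

variable {e : StrongDual ℂ X ≃ₗᵢ⋆[ℂ] N}

lemma WCont.tendsto {g : N → ℂ} (hg : WCont e g) {Λ : Type*} {U : Ultrafilter Λ} {y : Λ → N}
    {n : N} {R : ℝ} (hR : ∀ᶠ l in (U : Filter Λ), ‖y l‖ ≤ R) (hy : WLim e U y n) :
    Tendsto (fun l => g (y l)) U (𝓝 (g n)) :=
  hg (U.map y) n R hR hy

lemma wCont_apply (x : X) : WCont e fun y => e.symm y x := fun _ _ _ _ h => h x

lemma WCont.add {f g : N → ℂ} (hf : WCont e f) (hg : WCont e g) : WCont e fun y => f y + g y :=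
  fun U n R hR h => (hf U n R hR h).add (hg U n R hR h)

lemma WCont.const_mul {f : N → ℂ} (hf : WCont e f) (c : ℂ) : WCont e fun y => c * f y :=
  fun U n R hR h => (hf U n R hR h).const_mul c

lemma WCont.conj {f : N → ℂ} (hf : WCont e f) : WCont e fun y => starRingEnd ℂ (f y) :=
  fun U n R hR h => (Complex.continuous_conj.tendsto _).comp (hf U n R hR h)

lemma WCont.of_approx {g : N → ℂ}
    (h : ∀ ε > 0, ∃ g', WCont e g' ∧ ∀ y, ‖g y - g' y‖ ≤ ε * (1 + ‖y‖)) : WCont e g := by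
  intro U n R hR hn
  have hR0 : 0 ≤ R := by
    obtain ⟨l, hl⟩ := hR.exists
    exact (norm_nonneg _).trans hl
  rw [Metric.tendsto_nhds]
  intro ε hε
  obtain ⟨g', hg', hgg⟩ := h (ε / (3 * (1 + R))) (by positivity)
  have hnR := hn.norm_le (y := id) hR
  have key : ∀ y, ‖y‖ ≤ R → ‖g y - g' y‖ ≤ ε / 3 := fun y hy => by
    refine (hgg y).trans ?_
    calc ε / (3 * (1 + R)) * (1 + ‖y‖) ≤ ε / (3 * (1 + R)) * (1 + R) := by gcongr
      _ = ε / 3 := by field_simp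
  filter_upwards [hR, (Metric.tendsto_nhds.1 (hg' U n R hR hn)) (ε / 3) (by positivity)]
    with z hz hz2
  have h1 := key z hz
  have h2 := key n hnR
  rw [← dist_eq_norm] at h1 h2
  rw [dist_comm] at h2
  have := dist_triangle4 (g z) (g' z) (g' n) (g n)
  linarith

end WCont

section Order

variable {X N : Type*} [NormedAddCommGroup X] [NormedSpace ℂ X]
  [CStarAlgebra N] [PartialOrder N] [StarOrderedRing N] {e : StrongDual ℂ X ≃ₗᵢ⋆[ℂ] N}

lemma WCont.comp_star {f : N → ℂ} (hf : WCont e f) : WCont e fun y => f (star y) := by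
  intro U n R hR h
  exact hf.tendsto (U := U) (y := fun z => star z) (R := R) (by simpa using hR) (h.star hR)

lemma norm_sub_le_of_mem_Icc {p q x : N} (h1 : q ≤ p) (h2 : p ≤ x) :
    ‖p‖ ≤ ‖q‖ + ‖x - q‖ := by
  have : ‖p - q‖ ≤ ‖x - q‖ :=
    CStarAlgebra.norm_le_norm_of_nonneg_of_le (sub_nonneg.2 h1) (sub_le_sub_right h2 q)
  calc ‖p‖ = ‖q + (p - q)‖ := by rw [add_sub_cancel]
    _ ≤ _ := (norm_add_le _ _).trans (by gcongr)

lemma eventually_norm_le_of_le {s : Set N} {x : N} (hx : x ∈ upperBounds s) (p₀ : s)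
    {U : Ultrafilter s} (hU : (U : Filter s) ≤ atTop) :
    ∀ᶠ p : s in (U : Filter s), ‖(p : N)‖ ≤ ‖(p₀ : N)‖ + ‖x - p₀‖ := by
  filter_upwards [hU (eventually_ge_atTop p₀)] with p hp
  exact norm_sub_le_of_mem_Icc hp (hx p.2)

lemma WLim.isLUB {s : Set N} {x n : N} (hx : x ∈ upperBounds s) (hs : s.Nonempty)
    {U : Ultrafilter s} (hU : (U : Filter s) ≤ atTop)
    (hn : WLim e U (fun p : s => (p : N)) n) : IsLUB s n := by
  obtain ⟨p₀, hp₀⟩ := hs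
  have hb := eventually_norm_le_of_le hx ⟨p₀, hp₀⟩ hU
  refine ⟨fun p hp => sub_nonneg.1 ?_, fun z hz => sub_nonneg.1 ?_⟩
  · refine (hn.sub (WLim.const p)).nonneg (R := ‖p₀‖ + ‖x - p₀‖ + ‖p‖) ?_ ?_
    · filter_upwards [hb] with q hq using (norm_sub_le _ _).trans (by gcongr)
    · filter_upwards [hU (eventually_ge_atTop (⟨p, hp⟩ : s))] with q hq using sub_nonneg.2 hq
  · refine ((WLim.const z).sub hn).nonneg (R := ‖z‖ + (‖p₀‖ + ‖x - p₀‖)) ?_ ?_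
    · filter_upwards [hb] with q hq using (norm_sub_le _ _).trans (by gcongr)
    · exact Eventually.of_forall fun q => sub_nonneg.2 (hz q.2)

lemma wLim_of_isLUB (e : StrongDual ℂ X ≃ₗᵢ⋆[ℂ] N) {s : Set N} {x : N} (hx : IsLUB s x)
    (hs : s.Nonempty) {U : Ultrafilter s} (hU : (U : Filter s) ≤ atTop) :
    (∃ R, ∀ᶠ p : s in (U : Filter s), ‖(p : N)‖ ≤ R) ∧ WLim e U (fun p : s => (p : N)) x := by
  obtain ⟨p₀, hp₀⟩ := hs
  have hb := eventually_norm_le_of_le hx.1 ⟨p₀, hp₀⟩ hU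
  obtain ⟨n, hn, -⟩ := WLim.exists e hb
  refine ⟨⟨_, hb⟩, ?_⟩
  rwa [hx.unique (hn.isLUB hx.1 ⟨p₀, hp₀⟩ hU)]

lemma exists_isLUB (e : StrongDual ℂ X ≃ₗᵢ⋆[ℂ] N) {s : Set N} {x : N} (hx : x ∈ upperBounds s)
    (hs : s.Nonempty) (hd : DirectedOn (· ≤ ·) s) : ∃ n, IsLUB s n := by
  have : Nonempty s := hs.to_subtype
  have : IsDirectedOrder s := ⟨fun a b => by
    obtain ⟨c, hc, h1, h2⟩ := hd a a.2 b b.2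
    exact ⟨⟨c, hc⟩, h1, h2⟩⟩
  have hU := Ultrafilter.of_le (atTop : Filter s)
  obtain ⟨p₀, hp₀⟩ := hs
  obtain ⟨n, hn, -⟩ := WLim.exists e (eventually_norm_le_of_le hx ⟨p₀, hp₀⟩ hU)
  exact ⟨n, hn.isLUB hx ⟨p₀, hp₀⟩ hU⟩

/-- Positivity of a functional, with respect to the order of `N`. -/
def Pos (f : N →ₗ[ℂ] ℂ) : Prop := ∀ a : N, 0 ≤ a → 0 ≤ f a

lemma pos_iff {f : N →ₗ[ℂ] ℂ} : Pos f ↔ ∀ a : N, ∃ c : ℂ, f (star a * a) = star c * c := by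
  constructor
  · intro h a
    exact CStarAlgebra.nonneg_iff_eq_star_mul_self.1 (h _ (star_mul_self_nonneg a))
  · intro h a ha
    obtain ⟨b, rfl⟩ := CStarAlgebra.nonneg_iff_eq_star_mul_self.1 ha
    obtain ⟨c, hc⟩ := h b
    rw [hc]
    exact star_mul_self_nonneg c

lemma WCont.isNormalPosFunctional {f : N →ₗ[ℂ] ℂ} (hf : WCont e f) (h : Pos f) :
    IsNormalPosFunctional f := by
  refine ⟨pos_iff.1 h, fun s x hs _ hx => ?_⟩
  rw [tendsto_iff_ultrafilter]
  intro U hU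
  obtain ⟨⟨R, hR⟩, hlim⟩ := wLim_of_isLUB e hx hs hU
  exact hf.tendsto hR hlim

end Order

section Positive

variable {X : Type*} {N : Type u} [NormedAddCommGroup X] [NormedSpace ℂ X]
  [CStarAlgebra N]

lemma norm_le_of_re_le (e : StrongDual ℂ X ≃ₗᵢ⋆[ℂ] N) {y : N} {r : ℝ} (hr : 0 ≤ r)
    (h : ∀ x : X, ‖x‖ ≤ 1 → |(e.symm y x).re| ≤ r) : ‖y‖ ≤ r := by
  rw [← e.symm.norm_map y]
  refine ContinuousLinearMap.opNorm_le_of_unit_norm hr fun x hx => ?_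
  set z := e.symm y x with hz
  rcases eq_or_ne z 0 with h0 | h0
  · simpa [h0] using hr
  have hz0 : (‖z‖ : ℂ) ≠ 0 := by simpa using h0
  have h1 := h ((starRingEnd ℂ z / ‖z‖) • x) (by
    rw [norm_smul, hx, norm_div, RCLike.norm_conj, Complex.norm_real, norm_norm, mul_one]
    exact div_self_le_one _)
  have h2 : e.symm y ((starRingEnd ℂ z / ‖z‖) • x) = (‖z‖ : ℂ) := by
    rw [map_smul, ← hz, smul_eq_mul, div_mul_eq_mul_div, mul_comm, Complex.mul_conj,
      Complex.normSq_eq_norm_sq]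
    push_cast
    field_simp
  rw [h2, Complex.ofReal_re, abs_norm] at h1
  exact h1

variable [CompleteSpace X] [PartialOrder N] [StarOrderedRing N]

lemma exists_pos_wCont (e : StrongDual ℂ X ≃ₗᵢ⋆[ℂ] N) {f : N} (hf : IsSelfAdjoint f)
    (hneg : ¬ 0 ≤ f) : ∃ G : N →ₗ[ℂ] ℂ, Pos G ∧ WCont e G ∧ (G f).re < 0 := by
  obtain ⟨δ, hδ, hfδ⟩ : ∃ δ : ℝ, 0 < δ ∧ ¬ 0 ≤ f + δ • (1 : N) := by
    by_contra! hcon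
    have hlim : Tendsto (fun n : ℕ => f + (1 / ((n : ℝ) + 1)) • (1 : N)) atTop
        (𝓝 (f + (0 : ℝ) • (1 : N))) :=
      (tendsto_one_div_add_atTop_nhds_zero_nat.smul_const _).const_add _
    have := CStarAlgebra.isClosed_nonneg.mem_of_tendsto hlim (Eventually.of_forall fun n =>
      hcon _ (by positivity))
    exact hneg (by simpa using this)
  set C : Set N := {v | IsSelfAdjoint v ∧ 0 ≤ f + δ • v} with hC
  let re : X → N →ₗ[ℝ] ℝ := fun x =>
    { toFun := fun y => (e.symm y x).re
      map_add' := fun y z => by simp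
      map_smul' := fun r y => by
        rw [← Complex.coe_smul, map_smulₛₗ]
        simp }
  have hconv : Convex ℝ C := by
    rintro y ⟨hy, hy'⟩ z ⟨hz, hz'⟩ s t hs ht hst
    refine ⟨((IsSelfAdjoint.all s).smul hy).add ((IsSelfAdjoint.all t).smul hz), ?_⟩
    have : f + δ • (s • y + t • z) = s • (f + δ • y) + t • (f + δ • z) := by
      have hf1 : f = s • f + t • f := by rw [← add_smul, hst, one_smul]
      conv_lhs => rw [hf1]
      module
    rw [this]
    exact add_nonneg (smul_nonneg hs hy') (smul_nonneg ht hz')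
  have hball : ∀ y ∈ C, 1 < ‖y‖ := by
    rintro y ⟨hy, hy'⟩
    by_contra! hle
    refine hfδ (hy'.trans ?_)
    have := le_smul_one_of_norm_le hy hle
    rw [one_smul] at this
    gcongr
  obtain ⟨J, w, a, hw, ha, hsep⟩ := exists_summable_separation (V := N)
    (Ω := {ω | ∃ x : X, ‖x‖ ≤ 1 ∧ ω = re x}) hconv
    (by
      rintro _ ⟨x, hx, rfl⟩ y
      refine (Complex.abs_re_le_norm _).trans ((ContinuousLinearMap.le_opNorm _ _).trans ?_)
      rw [LinearIsometryEquiv.norm_map]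
      exact mul_le_of_le_one_right (norm_nonneg _) hx)
    (fun y r hr h => norm_le_of_re_le e hr fun x hx => h _ ⟨x, hx, rfl⟩)
    (by
      intro R U hU
      have hR := hU.mono fun z hz => hz.2
      obtain ⟨y, hy, -⟩ := WLim.exists e (y := fun z : N => z) hR
      refine ⟨y, ⟨hy.isSelfAdjoint hR (hU.mono fun z hz => hz.1.1), ?_⟩, ?_⟩
      · refine ((WLim.const f).add (hy.rsmul δ)).nonneg (R := ‖f‖ + δ * R) ?_
          (hU.mono fun z hz => hz.1.2)
        filter_upwards [hR] with z hz
        refine (norm_add_le _ _).trans ?_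
        rw [norm_smul, Real.norm_of_nonneg hδ.le]
        gcongr
      · rintro _ ⟨x, -, rfl⟩
        exact (Complex.continuous_re.tendsto _).comp (hy x))
    hball
  choose x hx hwx using hw
  have hsx : Summable fun j => (a j : ℂ) • x j := by
    refine Summable.of_norm_bounded ha fun j => ?_
    rw [norm_smul, Complex.norm_real]
    exact mul_le_of_le_one_right (norm_nonneg _) (hx j)
  set x₀ := ∑' j, (a j : ℂ) • x j with hx₀
  have hval : ∀ y, ∑' j, a j * w j y = (e.symm y x₀).re := by
    intro y
    have h1 := Complex.hasSum_re ((e.symm y).hasSum hsx.hasSum)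
    refine HasSum.tsum_eq ?_
    convert h1 using 2 with j
    simp [hwx, re]
  have hge : ∀ y ∈ C, 1 ≤ (e.symm y x₀).re := fun y hy => (hsep y hy).trans_eq (hval y)
  let G : N →ₗ[ℂ] ℂ :=
    { toFun := fun y => (1 / 2 : ℂ) * (starRingEnd ℂ (e.symm y x₀) + e.symm (star y) x₀)
      map_add' := fun y z => by simp; ring
      map_smul' := fun c y => by simp [map_smulₛₗ]; ring }
  have hGsa : ∀ y, IsSelfAdjoint y → G y = ((e.symm y x₀).re : ℂ) := by
    intro y hy
    change (1 / 2 : ℂ) * (starRingEnd ℂ (e.symm y x₀) + e.symm (star y) x₀) = _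
    rw [hy.star_eq, add_comm, Complex.add_conj]
    push_cast; ring
  have hf0 : (-(δ⁻¹ • f)) ∈ C := by
    refine ⟨((IsSelfAdjoint.all δ⁻¹).smul hf).neg, ?_⟩
    rw [smul_neg, smul_inv_smul₀ hδ.ne', add_neg_cancel]
  refine ⟨G, fun p hp => ?_, ?_, ?_⟩
  · have hpsa := IsSelfAdjoint.of_nonneg hp
    rw [hGsa p hpsa]
    have h1 : ∀ t : ℝ, 0 ≤ t → 1 ≤ (re x₀ (-(δ⁻¹ • f))) + t * re x₀ p := by
      intro t ht
      have := hge (-(δ⁻¹ • f) + t • p) ⟨hf0.1.add ((IsSelfAdjoint.all t).smul hpsa), by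
        rw [smul_add, ← add_assoc]
        exact add_nonneg hf0.2 (smul_nonneg hδ.le (smul_nonneg ht hp))⟩
      change 1 ≤ re x₀ _ at this
      rwa [map_add, map_smul] at this
    have h2 : 0 ≤ re x₀ p := by
      by_contra! hlt
      have := h1 (|re x₀ (-(δ⁻¹ • f))| / -(re x₀ p)) (by
        have := neg_pos.2 hlt; positivity)
      have h3 : |re x₀ (-(δ⁻¹ • f))| / -(re x₀ p) * re x₀ p = -|re x₀ (-(δ⁻¹ • f))| := by
        field_simp [hlt.ne]
      rw [h3] at this
      linarith [le_abs_self (re x₀ (-(δ⁻¹ • f)))]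
    exact_mod_cast h2
  · exact ((wCont_apply x₀).conj.add (wCont_apply x₀).comp_star).const_mul _
  · rw [hGsa f hf, Complex.ofReal_re]
    have := hge _ hf0
    change 1 ≤ re x₀ _ at this
    rw [map_neg, map_smul, smul_eq_mul] at this
    change re x₀ f < 0
    by_contra! h
    have : 0 ≤ δ⁻¹ * re x₀ f := by positivity
    linarith

end Positive

section Riesz

variable {V : Type*} [AddCommGroup V] [Module ℝ V]

lemma exists_riesz_approx (g : V →ₗ[ℝ] ℝ) (κ : V →ₗ[ℝ] V →ₗ[ℝ] ℝ) (hsymm : ∀ y z, κ y z = κ z y)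
    {W : ℝ} (hg : ∀ y, g y ^ 2 ≤ W * κ y y) (hκ : ∀ y, 0 ≤ κ y y) {η : ℝ} (hη : 0 < η) :
    ∃ z, ∀ y, (g y - κ z y) ^ 2 ≤ η * κ y y := by
  have hbdd : BddAbove (Set.range fun z => 2 * g z - κ z z) := by
    refine ⟨|W|, ?_⟩
    rintro _ ⟨z, rfl⟩
    have h1 := hg z
    have h2 := hκ z
    have h3 : W * κ z z ≤ |W| * κ z z := by gcongr; exact le_abs_self W
    have h4 : |g z| ≤ (|W| + κ z z) / 2 := by
      apply abs_le_of_sq_le_sq _ (by positivity)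
      nlinarith [sq_nonneg (|W| - κ z z)]
    change 2 * g z - κ z z ≤ |W|
    linarith [le_abs_self (g z)]
  obtain ⟨_, ⟨z, rfl⟩, hz⟩ := exists_lt_of_lt_csSup (Set.range_nonempty _)
    (sub_lt_self (sSup (Set.range fun z => 2 * g z - κ z z)) hη)
  refine ⟨z, fun y => ?_⟩
  have h1 : ∀ t : ℝ, 0 ≤ κ y y * (t * t) + (-(2 * (g y - κ z y))) * t + η := by
    intro t
    have h2 := le_csSup hbdd ⟨z + t • y, rfl⟩
    simp only [map_add, map_smul, LinearMap.add_apply, LinearMap.smul_apply, smul_eq_mul,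
      hsymm y z] at h2
    linarith
  have := discrim_le_zero h1
  rw [discrim] at this
  linarith

end Riesz

section Functional

variable {N : Type*} [CStarAlgebra N] [PartialOrder N] [StarOrderedRing N]

lemma Pos.mono {ω : N →ₗ[ℂ] ℂ} (h : Pos ω) {a b : N} (hab : a ≤ b) : ω a ≤ ω b := by
  have := h _ (sub_nonneg.2 hab)
  rwa [map_sub, sub_nonneg] at this

lemma Pos.re_mono {ω : N →ₗ[ℂ] ℂ} (h : Pos ω) {a b : N} (hab : a ≤ b) : (ω a).re ≤ (ω b).re :=
  (Complex.le_def.1 (h.mono hab)).1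

omit [StarOrderedRing N] in
lemma Pos.re_nonneg {ω : N →ₗ[ℂ] ℂ} (h : Pos ω) {a : N} (ha : 0 ≤ a) : 0 ≤ (ω a).re :=
  (Complex.le_def.1 (h a ha)).1

lemma Pos.im_eq_zero {ω : N →ₗ[ℂ] ℂ} (h : Pos ω) {a : N} (ha : IsSelfAdjoint a) :
    (ω a).im = 0 := by
  have h1 := h _ (sub_nonneg.2 (le_smul_one_of_norm_le ha le_rfl))
  have h2 := h _ (smul_nonneg (norm_nonneg a) (zero_le_one (α := N)))
  rw [map_sub] at h1
  have h3 := (Complex.le_def.1 h1).2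
  have h4 := (Complex.le_def.1 h2).2
  simp only [Complex.sub_im, Complex.zero_im] at h3 h4
  linarith

lemma Pos.map_star {ω : N →ₗ[ℂ] ℂ} (h : Pos ω) (a : N) : ω (star a) = starRingEnd ℂ (ω a) := by
  obtain ⟨x, y, hx, hy, rfl⟩ := exists_re_im a
  have e1 := h.im_eq_zero hx
  have e2 := h.im_eq_zero hy
  apply Complex.ext <;> simp [hx.star_eq, hy.star_eq, e1, e2]

lemma Pos.cauchy_schwarz {ω : N →ₗ[ℂ] ℂ} (h : Pos ω) (a b : N) :
    ‖ω (star a * b)‖ ^ 2 ≤ (ω (star a * a)).re * (ω (star b * b)).re := by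
  let c : PreInnerProductSpace.Core ℂ N :=
    { inner := fun a b => ω (star a * b)
      conj_inner_symm := fun x y => by rw [← h.map_star]; simp
      re_inner_nonneg := fun x => h.re_nonneg (star_mul_self_nonneg x)
      add_left := fun x y z => by simp [add_mul]
      smul_left := fun x y r => by simp }
  have := @InnerProductSpace.Core.inner_mul_inner_self_le ℂ N _ _ _ c a b
  change ‖ω (star a * b)‖ * ‖ω (star b * a)‖ ≤ (ω (star a * a)).re * (ω (star b * b)).re at this
  have h2 : ‖ω (star b * a)‖ = ‖ω (star a * b)‖ := by
    have : star b * a = star (star a * b) := by simp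
    rw [this, h.map_star, RCLike.norm_conj]
  rwa [h2, ← sq] at this

lemma star_mul_self_le (y : N) : star y * y ≤ (‖y‖ ^ 2) • (1 : N) := by
  refine le_smul_one_of_norm_le (IsSelfAdjoint.star_mul_self y) ?_
  rw [CStarRing.norm_star_mul_self, sq]

lemma Pos.re_star_mul_self_le {ω : N →ₗ[ℂ] ℂ} (h : Pos ω) (y : N) :
    (ω (star y * y)).re ≤ (ω 1).re * ‖y‖ ^ 2 := by
  have := h.re_mono (star_mul_self_le y)
  rwa [← Complex.coe_smul, map_smul, smul_eq_mul, Complex.re_ofReal_mul, mul_comm] at this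

lemma mul_self_le_of_le_one {d : N} (h0 : 0 ≤ d) (h1 : d ≤ 1) : d * d ≤ d := by
  have hc : Commute d (1 - d) := (Commute.one_right d).sub_right (Commute.refl d)
  have := hc.mul_nonneg h0 (sub_nonneg.2 h1)
  rw [mul_sub, mul_one, sub_nonneg] at this
  exact this

lemma Pos.norm_jordan_le {ω : N →ₗ[ℂ] ℂ} (h : Pos ω) {d : N} (h0 : 0 ≤ d) (h1 : d ≤ 1) (y : N) :
    ‖ω (d * y + y * d)‖ ≤ 2 * (√((ω d).re * (ω 1).re) * ‖y‖) := by
  have hd := (IsSelfAdjoint.of_nonneg h0).star_eq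
  have hdd := h.re_mono (mul_self_le_of_le_one h0 h1)
  have key : ∀ z, ‖ω (d * z)‖ ≤ √((ω d).re * (ω 1).re) * ‖z‖ := by
    intro z
    have h2 := h.cauchy_schwarz d z
    rw [hd] at h2
    have h3 := h.re_star_mul_self_le z
    have h4 := h.re_nonneg h0
    have h5 := h.re_nonneg (star_mul_self_nonneg z)
    have h6 := h.re_nonneg (zero_le_one (α := N))
    refine le_of_sq_le_sq (h2.trans ?_) (by positivity)
    rw [mul_pow, Real.sq_sqrt (by positivity)]
    calc _ ≤ (ω d).re * ((ω 1).re * ‖z‖ ^ 2) := by gcongr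
      _ = _ := by ring
  rw [map_add]
  refine (norm_add_le _ _).trans ?_
  have h2 : ‖ω (y * d)‖ = ‖ω (d * star y)‖ := by
    have : y * d = star (d * star y) := by simp [hd]
    rw [this, h.map_star, RCLike.norm_conj]
  rw [h2]
  have h3 := key y
  have h4 := key (star y)
  rw [norm_star] at h4
  linarith

omit [PartialOrder N] [StarOrderedRing N] in
lemma norm_le_of_norm_le_selfAdjoint (L : N →ₗ[ℂ] ℂ) {c : ℝ} (hc : 0 ≤ c)
    (h : ∀ y, IsSelfAdjoint y → ‖L y‖ ≤ c * ‖y‖) (y : N) : ‖L y‖ ≤ 2 * c * ‖y‖ := by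
  obtain ⟨x, z, hx, hz, rfl⟩ := exists_re_im y
  have h1 := norm_sq_le_of_re_im hx hz
  have h2 : ‖x‖ ≤ ‖x + Complex.I • z‖ := by
    have := norm_sq_le_of_re_im hz hx.neg
    have e1 : z + Complex.I • (-x) = (-Complex.I) • (x + Complex.I • z) := by
      rw [smul_add, smul_smul]; simp [add_comm]
    rw [e1, norm_smul] at this
    simpa using this
  rw [map_add, map_smul]
  calc _ ≤ ‖L x‖ + ‖Complex.I • L z‖ := norm_add_le _ _
    _ = ‖L x‖ + ‖L z‖ := by simp
    _ ≤ c * ‖x‖ + c * ‖z‖ := add_le_add (h x hx) (h z hz)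
    _ ≤ c * ‖x + Complex.I • z‖ + c * ‖x + Complex.I • z‖ := by gcongr
    _ = _ := by ring

end Functional

section Sakai

variable {X : Type*} {N : Type u} [NormedAddCommGroup X] [NormedSpace ℂ X] [CStarAlgebra N]
  [PartialOrder N] [StarOrderedRing N] {e : StrongDual ℂ X ≃ₗᵢ⋆[ℂ] N}

omit [StarOrderedRing N] in
lemma tendsto_re_of_normal {ω : N →ₗ[ℂ] ℂ} (hω : IsNormalPosFunctional ω) {s : Set N} {x : N}
    (hs : s.Nonempty) (hd : IsChain (· ≤ ·) s) (hx : IsLUB s x) :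
    Tendsto (fun p : s => (ω p).re) atTop (𝓝 (ω x).re) :=
  (Complex.continuous_re.tendsto _).comp (hω.2 s x hs hd.directedOn hx)

omit [CStarAlgebra N] [StarOrderedRing N] in
lemma atTop_neBot_of_isChain {s : Set N} (hs : s.Nonempty) (hd : IsChain (· ≤ ·) s) :
    (atTop : Filter s).NeBot := by
  have : Nonempty s := hs.to_subtype
  have : IsDirectedOrder s := ⟨fun a b => by
    obtain ⟨c, hc, h1, h2⟩ := hd.directedOn a a.2 b b.2
    exact ⟨⟨c, hc⟩, h1, h2⟩⟩
  infer_instance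

lemma wCont_jordan_of_isLUB {ω : N →ₗ[ℂ] ℂ} (hω : IsNormalPosFunctional ω) {s : Set N} {x : N}
    (hs : s.Nonempty) (hd : IsChain (· ≤ ·) s) (hx : IsLUB s x) (hs0 : ∀ p ∈ s, 0 ≤ p) (hx1 : x ≤ 1)
    (hJ : ∀ p ∈ s, WCont e fun y => ω (p * y + y * p)) :
    WCont e fun y => ω (x * y + y * x) := by
  have hpos : Pos ω := pos_iff.2 hω.1
  have := atTop_neBot_of_isChain hs hd
  refine WCont.of_approx fun ε hε => ?_
  have h1 := hpos.re_nonneg (zero_le_one (α := N))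
  obtain ⟨p, hp⟩ := ((Metric.tendsto_nhds.1 (tendsto_re_of_normal hω hs hd hx))
    ((ε / 2) ^ 2 / ((ω 1).re + 1)) (by positivity)).exists
  refine ⟨_, hJ p p.2, fun y => ?_⟩
  rw [← map_sub]
  have e1 : x * y + y * x - (p * y + y * p) = (x - p) * y + y * (x - p) := by noncomm_ring
  rw [e1]
  have hpx : (p : N) ≤ x := hx.1 p.2
  refine (hpos.norm_jordan_le (sub_nonneg.2 hpx)
    ((sub_le_self x (hs0 p p.2)).trans hx1) y).trans ?_
  have h2 : √((ω (x - p)).re * (ω 1).re) ≤ ε / 2 := by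
    apply Real.sqrt_le_iff.2 ⟨by positivity, ?_⟩
    rw [dist_comm, Real.dist_eq, ← Complex.sub_re, ← map_sub,
      abs_of_nonneg (hpos.re_nonneg (sub_nonneg.2 hpx)), lt_div_iff₀ (by positivity)] at hp
    have := hpos.re_nonneg (sub_nonneg.2 hpx)
    nlinarith
  calc 2 * (√((ω (x - p)).re * (ω 1).re) * ‖y‖) ≤ 2 * (ε / 2 * ‖y‖) := by gcongr
    _ ≤ ε * (1 + ‖y‖) := by linarith

/-- If `ω` is dominated by a weak⋆ continuous functional on the elements below `b`, then its
Jordan multiple by `b` is weak⋆ continuous. -/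
lemma wCont_jordan_of_dominated {ω τ : N →ₗ[ℂ] ℂ} (hω : Pos ω) (hτ : Pos τ) (hτc : WCont e τ)
    {b : N} (hb0 : 0 ≤ b) (hb1 : b ≤ 1) (hdom : ∀ c, 0 ≤ c → c ≤ b → (ω c).re ≤ (τ c).re) :
    WCont e fun y => ω (b * y + y * b) := by
  have hbsa := IsSelfAdjoint.of_nonneg hb0
  have hbb := mul_self_le_of_le_one hb0 hb1
  have hbb1 : b * b ≤ 1 := hbb.trans hb1
  have hconj : ∀ y : N, IsSelfAdjoint y → 0 ≤ b * (y * y) * b ∧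
      b * (y * y) * b ≤ (‖y‖ ^ 2) • (b * b) := by
    intro y hy
    have h1 := star_mul_self_nonneg y
    have h2 := star_mul_self_le y
    rw [hy.star_eq] at h1 h2
    refine ⟨hbsa.conjugate_nonneg h1, ?_⟩
    have := hbsa.conjugate_nonneg (sub_nonneg.2 h2)
    rw [mul_sub, sub_mul, sub_nonneg, mul_smul_comm, mul_one, smul_mul_assoc] at this
    exact this
  have hq : ∀ y : N, IsSelfAdjoint y → (ω (b * (y * y) * b)).re ≤ (τ (b * (y * y) * b)).re := by
    intro y hy
    rcases eq_or_ne y 0 with rfl | hy0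
    · simp
    have hn : 0 < ‖y‖ ^ 2 := by have := norm_pos_iff.2 hy0; positivity
    obtain ⟨h1, h2⟩ := hconj y hy
    have h3 := hdom ((‖y‖ ^ 2)⁻¹ • (b * (y * y) * b)) (smul_nonneg (by positivity) h1) (by
      refine le_trans ?_ hbb
      have := smul_le_smul_of_nonneg_left h2 (inv_nonneg.2 hn.le)
      rwa [inv_smul_smul₀ hn.ne'] at this)
    rw [← Complex.coe_smul, map_smul, map_smul, smul_eq_mul, smul_eq_mul, Complex.re_ofReal_mul,
      Complex.re_ofReal_mul] at h3
    exact le_of_mul_le_mul_left h3 (by positivity)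
  have hqT : ∀ y : N, IsSelfAdjoint y → (τ (b * (y * y) * b)).re ≤ (τ 1).re * ‖y‖ ^ 2 := by
    intro y hy
    have := hτ.re_mono ((hconj y hy).2.trans (smul_le_smul_of_nonneg_left hbb1 (by positivity)))
    rwa [← Complex.coe_smul, map_smul, smul_eq_mul, Complex.re_ofReal_mul, mul_comm] at this
  let g : selfAdjoint N →ₗ[ℝ] ℝ :=
    { toFun := fun y => (ω (y * b)).re
      map_add' := fun y z => by simp [add_mul]
      map_smul' := fun r y => by
        simp only [selfAdjoint.val_smul, smul_mul_assoc, RingHom.id_apply, smul_eq_mul]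
        rw [← Complex.coe_smul, map_smul, smul_eq_mul, Complex.re_ofReal_mul] }
  have hsm : ∀ (r : ℝ) (y : N), (τ (r • y)).re = r * (τ y).re := fun r y => by
    rw [← Complex.coe_smul, map_smul, smul_eq_mul, Complex.re_ofReal_mul]
  let κ : selfAdjoint N →ₗ[ℝ] selfAdjoint N →ₗ[ℝ] ℝ :=
    LinearMap.mk₂ ℝ (fun y z => (τ (b * (y * z + z * y) * b)).re / 2)
      (fun x y z => by
        simp only [AddSubgroup.coe_add, add_mul, mul_add, map_add, Complex.add_re]; ring)
      (fun r y z => by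
        simp only [selfAdjoint.val_smul, smul_mul_assoc, mul_smul_comm, ← smul_add, hsm]
        simp only [smul_eq_mul]; ring)
      (fun x y z => by
        simp only [AddSubgroup.coe_add, add_mul, mul_add, map_add, Complex.add_re]; ring)
      (fun r y z => by
        simp only [selfAdjoint.val_smul, smul_mul_assoc, mul_smul_comm, ← smul_add, hsm]
        simp only [smul_eq_mul]; ring)
  have hκ : ∀ y : selfAdjoint N, κ y y = (τ (b * (y * y) * b)).re := by
    intro y
    change (τ (b * ((y : N) * y + y * y) * b)).re / 2 = _
    rw [mul_add, add_mul, map_add, Complex.add_re]; ring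
  have hω1 := hω.re_nonneg (zero_le_one (α := N))
  have hτ1 := hτ.re_nonneg (zero_le_one (α := N))
  refine WCont.of_approx fun ε hε => ?_
  obtain ⟨z, hz⟩ := exists_riesz_approx g κ
    (fun y z => by change (τ (b * ((y : N) * z + z * y) * b)).re / 2 = _; rw [add_comm]; rfl)
    (W := (ω 1).re)
    (fun y => by
      have h1 := hω.cauchy_schwarz 1 ((y : N) * b)
      have h2 : star ((y : N) * b) * (y * b) = b * (y * y) * b := by
        rw [star_mul, hbsa.star_eq, y.2.star_eq]; noncomm_ring
      rw [h2, star_one, one_mul, one_mul] at h1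
      have h3 : g y ^ 2 ≤ ‖ω ((y : N) * b)‖ ^ 2 := by
        rw [← sq_abs]
        gcongr
        exact Complex.abs_re_le_norm _
      rw [hκ]
      exact h3.trans (h1.trans (mul_le_mul_of_nonneg_left (hq y y.2) hω1)))
    (fun y => by rw [hκ]; exact hτ.re_nonneg (hconj y y.2).1)
    (η := (ε / 4) ^ 2 / ((τ 1).re + 1)) (by positivity)
  let L : N →ₗ[ℂ] ℂ :=
    { toFun := fun y => ω (b * y + y * b) - τ (b * (z * y + y * z) * b)
      map_add' := fun y z => by simp only [mul_add, add_mul, map_add]; ring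
      map_smul' := fun c y => by
        simp only [mul_smul_comm, smul_mul_assoc, ← smul_add, map_smul, smul_eq_mul,
          RingHom.id_apply]
        ring }
  have hL : ∀ y, IsSelfAdjoint y → ‖L y‖ ≤ ε / 2 * ‖y‖ := by
    intro y hy
    have h1 := hz ⟨y, hy⟩
    rw [hκ] at h1
    have h2 : L y = ((2 * (g ⟨y, hy⟩ - κ z ⟨y, hy⟩) : ℝ) : ℂ) := by
      change ω (b * y + y * b) - τ (b * (z * y + y * z) * b) =
        ((2 * ((ω (y * b)).re - (τ (b * (z * y + y * z) * b)).re / 2) : ℝ) : ℂ)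
      have e1 : ω (b * y) = starRingEnd ℂ (ω (y * b)) := by
        rw [← hω.map_star, star_mul, hbsa.star_eq, hy.star_eq]
      have e2 : IsSelfAdjoint (b * ((z : N) * y + y * z) * b) := by
        simp only [IsSelfAdjoint, star_mul, star_add, hbsa.star_eq, hy.star_eq, z.2.star_eq]
        noncomm_ring
      have e3 := hτ.im_eq_zero e2
      rw [map_add, e1]
      apply Complex.ext
      · simp; ring
      · simp [e3]
    rw [h2, Complex.norm_real, Real.norm_eq_abs, abs_mul, abs_of_pos (two_pos : (0:ℝ) < 2)]
    have h3 : |g ⟨y, hy⟩ - κ z ⟨y, hy⟩| ≤ ε / 4 * ‖y‖ := by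
      apply abs_le_of_sq_le_sq _ (by positivity)
      refine h1.trans ?_
      calc _ ≤ (ε / 4) ^ 2 / ((τ 1).re + 1) * ((τ 1).re * ‖y‖ ^ 2) := by
            gcongr; exact hqT y hy
        _ = ((ε / 4) ^ 2 * ‖y‖ ^ 2) * ((τ 1).re / ((τ 1).re + 1)) := by ring
        _ ≤ ((ε / 4) ^ 2 * ‖y‖ ^ 2) * 1 := by
            gcongr
            exact (div_le_one (by positivity)).2 (by linarith)
        _ = _ := by ring
    linarith
  refine ⟨fun y => τ (b * (z * y + y * z) * b), ?_, fun y => ?_⟩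
  · intro U n R hR hn
    have hR0 : 0 ≤ R := by
      obtain ⟨l, hl⟩ := hR.exists
      exact (norm_nonneg _).trans hl
    have hb1 : ∀ᶠ y in (U : Filter N), ‖(z : N) * y + y * z‖ ≤ ‖(z : N)‖ * R + R * ‖(z : N)‖ := by
      filter_upwards [hR] with y hy
      refine (norm_add_le _ _).trans (add_le_add ((norm_mul_le _ _).trans ?_)
        ((norm_mul_le _ _).trans ?_)) <;> gcongr
    have h1 : WLim e U (fun y => (z : N) * y + y * z) (z * n + n * z) :=
      WLim.jordan (y := id) hR hn z.2
    have h2 := WLim.conj hb1 h1 hbsa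
    refine hτc.tendsto (R := ‖b‖ * (‖(z : N)‖ * R + R * ‖(z : N)‖) * ‖b‖) ?_ h2
    filter_upwards [hb1] with y hy
    refine (norm_mul_le _ _).trans ?_
    gcongr
    exact (norm_mul_le _ _).trans (by gcongr)
  · have := norm_le_of_norm_le_selfAdjoint L (by positivity) hL y
    refine le_trans this ?_
    linarith

variable [CompleteSpace X]

/-- A normal positive functional is weak⋆ continuous on bounded sets. -/
theorem wCont_of_isNormalPosFunctional (e : StrongDual ℂ X ≃ₗᵢ⋆[ℂ] N) {ω : N →ₗ[ℂ] ℂ}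
    (hω : IsNormalPosFunctional ω) : WCont e ω := by
  have hpos : Pos ω := pos_iff.2 hω.1
  obtain ⟨a, ha⟩ := zorn_le₀ {a : N | (0 ≤ a ∧ a ≤ 1) ∧ WCont e fun y => ω (a * y + y * a)} (by
    intro c hc hchain
    rcases c.eq_empty_or_nonempty with rfl | hne
    · refine ⟨0, ⟨⟨le_rfl, zero_le_one⟩, ?_⟩, by simp⟩
      simp only [zero_mul, mul_zero, add_zero, map_zero]
      exact fun _ _ _ _ _ => tendsto_const_nhds
    · obtain ⟨x, hx⟩ := exists_isLUB e (x := 1) (fun p hp => (hc hp).1.2) hne hchain.directedOn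
      have hx1 : x ≤ 1 := hx.2 fun p hp => (hc hp).1.2
      obtain ⟨p, hp⟩ := hne
      exact ⟨x, ⟨⟨(hc hp).1.1.trans (hx.1 hp), hx1⟩,
        wCont_jordan_of_isLUB hω ⟨p, hp⟩ hchain hx (fun q hq => (hc hq).1.1) hx1
          fun q hq => (hc hq).2⟩, fun q hq => hx.1 hq⟩)
  obtain ⟨⟨⟨ha0, ha1⟩, haW⟩, hamax⟩ := ha
  rcases eq_or_ne (1 - a) 0 with h1 | h1
  · rw [sub_eq_zero] at h1
    rw [← h1] at haW
    have : (ω : N → ℂ) = fun y => (1 / 2 : ℂ) * ω (1 * y + y * 1) := by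
      ext y; rw [one_mul, mul_one, map_add]; ring
    rw [this]
    exact haW.const_mul _
  exfalso
  have hf0 : 0 ≤ 1 - a := sub_nonneg.2 ha1
  obtain ⟨τ₀, hτ₀, hτ₀c, hτ₀f⟩ := exists_pos_wCont e (IsSelfAdjoint.of_nonneg hf0).neg
    (fun h => h1 (le_antisymm (neg_nonneg.1 h) hf0))
  rw [map_neg, Complex.neg_re, neg_lt_zero] at hτ₀f
  have hωf := hpos.re_nonneg hf0
  set c : ℝ := ((ω (1 - a)).re + 1) / (τ₀ (1 - a)).re with hc
  have hc0 : 0 ≤ c := by positivity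
  set τ : N →ₗ[ℂ] ℂ := (c : ℂ) • τ₀ with hτdef
  have hτre : ∀ y, (τ y).re = c * (τ₀ y).re := fun y => by simp [hτdef]
  have hτpos : Pos τ := fun y hy => by
    have h2 := hτ₀ y hy
    have h3 : (0 : ℂ) ≤ c := by exact_mod_cast hc0
    exact mul_nonneg h3 h2
  have hτc : WCont e τ := hτ₀c.const_mul c
  have hτn := hτc.isNormalPosFunctional hτpos
  have hτf : (ω (1 - a)).re < (τ (1 - a)).re := by
    rw [hτre, hc, div_mul_cancel₀ _ hτ₀f.ne']; linarith
  obtain ⟨d, hd⟩ := zorn_le₀ {d : N | (0 ≤ d ∧ d ≤ 1 - a) ∧ (τ d).re ≤ (ω d).re} (by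
    intro s hs hchain
    rcases s.eq_empty_or_nonempty with rfl | hne
    · exact ⟨0, ⟨⟨le_rfl, hf0⟩, by simp⟩, by simp⟩
    · obtain ⟨x, hx⟩ := exists_isLUB e (x := 1 - a) (fun p hp => (hs hp).1.2) hne
        hchain.directedOn
      have := atTop_neBot_of_isChain hne hchain
      have hle := le_of_tendsto_of_tendsto' (tendsto_re_of_normal hτn hne hchain hx)
        (tendsto_re_of_normal hω hne hchain hx) fun p => (hs p.2).2
      obtain ⟨p, hp⟩ := hne
      exact ⟨x, ⟨⟨(hs hp).1.1.trans (hx.1 hp), hx.2 fun q hq => (hs hq).1.2⟩, hle⟩,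
        fun q hq => hx.1 hq⟩)
  obtain ⟨⟨⟨hd0, hd1⟩, hdτ⟩, hdmax⟩ := hd
  set b := 1 - a - d with hb
  have hb0 : 0 ≤ b := sub_nonneg.2 hd1
  have hba : b ≤ 1 - a := sub_le_self _ hd0
  have hbne : b ≠ 0 := by
    intro h
    rw [hb, sub_eq_zero] at h
    rw [h] at hτf
    linarith
  have hdom : ∀ x, 0 ≤ x → x ≤ b → (ω x).re ≤ (τ x).re := by
    intro x hx0 hxb
    by_contra! hlt
    have h2 : d + x ≤ d := hdmax ⟨⟨add_nonneg hd0 hx0, by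
      have := add_le_add_right hxb d
      rwa [hb, add_sub_cancel] at this⟩, by
      rw [map_add, map_add, Complex.add_re, Complex.add_re]; linarith⟩ (le_add_of_nonneg_right hx0)
    have h3 : x = 0 := le_antisymm (by simpa using h2) hx0
    simp [h3] at hlt
  have hbW := wCont_jordan_of_dominated hpos hτpos hτc hb0
    (hba.trans (sub_le_self _ ha0)) hdom
  have h2 : a + b ≤ a := hamax ⟨⟨add_nonneg ha0 hb0, by
      have := add_le_add_right hba a
      rwa [add_sub_cancel] at this⟩, by
      have := haW.add hbW
      refine (show (fun y => ω ((a + b) * y + y * (a + b))) = _ from ?_) ▸ this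
      ext y
      rw [← map_add]
      congr 1
      noncomm_ring⟩ (le_add_of_nonneg_right hb0)
  exact hbne (le_antisymm (by simpa using h2) hb0)

end Sakai

section Normal

variable {N : Type u} [CStarAlgebra N] [PartialOrder N] [StarOrderedRing N]

lemma atTop_neBot_of_directedOn {α : Type*} [Preorder α] {s : Set α} (hs : s.Nonempty)
    (hd : DirectedOn (· ≤ ·) s) : (atTop : Filter s).NeBot := by
  have : Nonempty s := hs.to_subtype
  have : IsDirectedOrder s := ⟨fun a b => by
    obtain ⟨c, hc, h1, h2⟩ := hd a a.2 b b.2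
    exact ⟨⟨c, hc⟩, h1, h2⟩⟩
  infer_instance

lemma isNormalPosFunctional_iff {ω : N →ₗ[ℂ] ℂ} : IsNormalPosFunctional ω ↔ Pos ω ∧
    ∀ (s : Set N) (x : N), s.Nonempty → DirectedOn (· ≤ ·) s → IsLUB s x →
      ∀ ε > 0, ∃ p ∈ s, (ω (x - p)).re < ε := by
  rw [IsNormalPosFunctional, ← pos_iff]
  refine and_congr_right fun hω => ?_
  refine forall₅_congr fun s x hs hd hx => ⟨fun h ε hε => ?_, fun h => ?_⟩
  · have := atTop_neBot_of_directedOn hs hd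
    obtain ⟨p, hp⟩ := ((Metric.tendsto_nhds.1 h) ε hε).exists
    refine ⟨p, p.2, ?_⟩
    rw [dist_comm, dist_eq_norm, ← map_sub] at hp
    exact (Complex.re_le_norm _).trans_lt hp
  · rw [Metric.tendsto_nhds]
    intro ε hε
    obtain ⟨p₀, hp₀, hlt⟩ := h ε hε
    filter_upwards [eventually_ge_atTop (⟨p₀, hp₀⟩ : s)] with p hp
    have h1 : p₀ ≤ p := hp
    have h2 : (p : N) ≤ x := hx.1 p.2
    have h3 := hω _ (sub_nonneg.2 h2)
    have h4 : ‖ω (x - p)‖ = (ω (x - p)).re := congrArg Complex.re (Complex.norm_of_nonneg' h3)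
    rw [dist_comm, dist_eq_norm, ← map_sub, h4]
    exact (hω.re_mono (sub_le_sub_left h1 x)).trans_lt hlt

lemma _root_.IsNormalPosFunctional.pos {ω : N →ₗ[ℂ] ℂ} (h : IsNormalPosFunctional ω) : Pos ω :=
  pos_iff.2 h.1

lemma _root_.IsNormalPosFunctional.of_le {ω ρ : N →ₗ[ℂ] ℂ} (hω : Pos ω) (hρ : IsNormalPosFunctional ρ)
    (h : ∀ a, 0 ≤ a → (ω a).re ≤ (ρ a).re) : IsNormalPosFunctional ω := by
  refine isNormalPosFunctional_iff.2 ⟨hω, fun s x hs hd hx ε hε => ?_⟩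
  obtain ⟨p, hp, hlt⟩ := (isNormalPosFunctional_iff.1 hρ).2 s x hs hd hx ε hε
  exact ⟨p, hp, (h _ (sub_nonneg.2 (hx.1 hp))).trans_lt hlt⟩

lemma _root_.IsNormalPosFunctional.smul {ω : N →ₗ[ℂ] ℂ} (h : IsNormalPosFunctional ω) {c : ℝ}
    (hc : 0 ≤ c) : IsNormalPosFunctional ((c : ℂ) • ω) := by
  refine ⟨pos_iff.1 fun a ha => ?_, fun s x hs hd hx => (h.2 s x hs hd hx).const_mul _⟩
  exact mul_nonneg (by exact_mod_cast hc) (h.pos a ha)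

lemma _root_.IsNormalPosFunctional.add {ω ρ : N →ₗ[ℂ] ℂ} (hω : IsNormalPosFunctional ω)
    (hρ : IsNormalPosFunctional ρ) : IsNormalPosFunctional (ω + ρ) :=
  ⟨pos_iff.1 fun a ha => add_nonneg (hω.pos a ha) (hρ.pos a ha),
    fun s x hs hd hx => (hω.2 s x hs hd hx).add (hρ.2 s x hs hd hx)⟩

/-- The functional `y ↦ ω (c⋆ y c)`. -/
def conjFunctional (ω : N →ₗ[ℂ] ℂ) (c : N) : N →ₗ[ℂ] ℂ :=
  ω ∘ₗ (LinearMap.mulLeft ℂ (star c)) ∘ₗ (LinearMap.mulRight ℂ c)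

omit [PartialOrder N] [StarOrderedRing N] in
lemma conjFunctional_apply (ω : N →ₗ[ℂ] ℂ) (c y : N) :
    conjFunctional ω c y = ω (star c * y * c) := by
  simp [conjFunctional, mul_assoc]

lemma Pos.conjFunctional {ω : N →ₗ[ℂ] ℂ} (h : Pos ω) (c : N) : Pos (conjFunctional ω c) :=
  fun a ha => by
    rw [conjFunctional_apply]
    exact h _ (star_left_conjugate_nonneg ha c)

lemma isNormalPosFunctional_conj_unit {ω : N →ₗ[ℂ] ℂ} (h : IsNormalPosFunctional ω) (c : Nˣ) :
    IsNormalPosFunctional (conjFunctional ω c) := by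
  refine isNormalPosFunctional_iff.2 ⟨h.pos.conjFunctional _, fun s x hs hd hx ε hε => ?_⟩
  have hmono : ∀ (d p q : N), p ≤ q → star d * p * d ≤ star d * q * d :=
    fun d p q hpq => star_left_conjugate_le_conjugate hpq d
  have hinv : ∀ z : N, star (c : N) * (star (↑c⁻¹ : N) * z * ↑c⁻¹) * c = z := by
    intro z
    have h1 : star (c : N) * star (↑c⁻¹ : N) = 1 := by rw [← star_mul]; simp
    calc _ = (star (c : N) * star (↑c⁻¹ : N)) * z * (↑c⁻¹ * c) := by noncomm_ring
      _ = z := by rw [h1]; simp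
  have hinv' : ∀ z : N, star (↑c⁻¹ : N) * (star (c : N) * z * c) * ↑c⁻¹ = z := by
    intro z
    have h1 : star (↑c⁻¹ : N) * star (c : N) = 1 := by rw [← star_mul]; simp
    calc _ = (star (↑c⁻¹ : N) * star (c : N)) * z * (c * ↑c⁻¹) := by noncomm_ring
      _ = z := by rw [h1]; simp
  obtain ⟨_, ⟨p, hp, rfl⟩, hlt⟩ := (isNormalPosFunctional_iff.1 h).2
    ((fun p => star (c : N) * p * c) '' s) (star (c : N) * x * c) (hs.image _)
    (by
      rintro _ ⟨p, hp, rfl⟩ _ ⟨q, hq, rfl⟩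
      obtain ⟨r, hr, h1, h2⟩ := hd p hp q hq
      exact ⟨_, ⟨r, hr, rfl⟩, hmono _ _ _ h1, hmono _ _ _ h2⟩)
    (by
      refine ⟨?_, fun z hz => ?_⟩
      · rintro _ ⟨p, hp, rfl⟩
        exact hmono _ _ _ (hx.1 hp)
      · rw [← hinv z]
        refine hmono _ _ _ (hx.2 fun p hp => ?_)
        rw [← hinv' p]
        exact hmono _ _ _ (hz ⟨p, hp, rfl⟩)) ε hε
  refine ⟨p, hp, ?_⟩
  rwa [conjFunctional_apply, mul_sub, sub_mul]

lemma _root_.IsNormalPosFunctional.conj {ω : N →ₗ[ℂ] ℂ} (h : IsNormalPosFunctional ω) (c : N) :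
    IsNormalPosFunctional (conjFunctional ω c) := by
  rcases subsingleton_or_nontrivial N with hN | hN
  · have : conjFunctional ω c = ω := by ext y; rw [Subsingleton.elim y 0, map_zero, map_zero]
    rwa [this]
  set r : ℝ := ‖c‖ + 1 with hr
  have hu : IsUnit (algebraMap ℂ N (r : ℂ) - c) := by
    rw [← spectrum.notMem_iff]
    intro hmem
    have := spectrum.norm_le_norm_of_mem hmem
    rw [Complex.norm_real, Real.norm_of_nonneg (by positivity)] at this
    linarith
  obtain ⟨v, hv⟩ := hu
  have hρ := ((isNormalPosFunctional_conj_unit h v).smul (c := 2) (by norm_num)).add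
    (h.smul (c := 2 * r ^ 2) (by positivity))
  refine IsNormalPosFunctional.of_le (h.pos.conjFunctional c) hρ fun a ha => ?_
  have h1 := h.pos.re_nonneg (star_left_conjugate_nonneg ha (v + (r : ℂ) • (1 : N)))
  have h2 : c = (r : ℂ) • (1 : N) - v := by
    rw [hv, Algebra.algebraMap_eq_smul_one]; abel
  have h3 : star c * a * c + star (v + (r : ℂ) • (1 : N)) * a * (v + (r : ℂ) • (1 : N))
      = (2 : ℂ) • (star (v : N) * a * v) + (2 * (r : ℂ) ^ 2) • a := by
    rw [h2]
    simp only [star_add, star_sub, star_smul, star_one, add_mul, mul_add, sub_mul, mul_sub,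
      smul_mul_assoc, mul_smul_comm, one_mul, mul_one, RCLike.star_def, Complex.conj_ofReal]
    module
  have h4 := congrArg (fun y => (ω y).re) h3
  simp only [map_add, map_smul, Complex.add_re] at h4
  simp only [LinearMap.add_apply, LinearMap.smul_apply, Complex.add_re, conjFunctional_apply]
  push_cast
  linarith

end Normal

section WStar

variable {X : Type*} {N : Type u} [NormedAddCommGroup X] [NormedSpace ℂ X] [CStarAlgebra N]
  [PartialOrder N] [StarOrderedRing N] [CompleteSpace X]

lemma nonneg_of_normal (e : StrongDual ℂ X ≃ₗᵢ⋆[ℂ] N) {f : N} (hf : IsSelfAdjoint f)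
    (h : ∀ ω : N →ₗ[ℂ] ℂ, IsNormalPosFunctional ω → 0 ≤ (ω f).re) : 0 ≤ f := by
  by_contra hneg
  obtain ⟨G, hG, hGc, hlt⟩ := exists_pos_wCont e hf hneg
  exact hlt.not_ge (h G (hGc.isNormalPosFunctional hG))

lemma eq_of_normal (e : StrongDual ℂ X ≃ₗᵢ⋆[ℂ] N) {a b : N}
    (h : ∀ ω : N →ₗ[ℂ] ℂ, IsNormalPosFunctional ω → ω a = ω b) : a = b := by
  obtain ⟨x, y, hx, hy, hxy⟩ := exists_re_im (a - b)
  have key : ∀ ω : N →ₗ[ℂ] ℂ, IsNormalPosFunctional ω → (ω x).re = 0 ∧ (ω y).re = 0 := by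
    intro ω hω
    have h1 : ω (a - b) = 0 := by rw [map_sub, h ω hω, sub_self]
    have h2 := hω.pos.im_eq_zero hx
    have h3 := hω.pos.im_eq_zero hy
    rw [hxy, map_add, map_smul] at h1
    have h4 := congrArg Complex.re h1
    have h5 := congrArg Complex.im h1
    simp [h2, h3] at h4 h5
    exact ⟨h4, h5⟩
  have hx0 : x = 0 := by
    refine le_antisymm (neg_nonneg.1 (nonneg_of_normal e hx.neg fun ω hω => ?_))
      (nonneg_of_normal e hx fun ω hω => (key ω hω).1.ge)
    rw [map_neg, Complex.neg_re, (key ω hω).1, neg_zero]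
  have hy0 : y = 0 := by
    refine le_antisymm (neg_nonneg.1 (nonneg_of_normal e hy.neg fun ω hω => ?_))
      (nonneg_of_normal e hy fun ω hω => (key ω hω).2.ge)
    rw [map_neg, Complex.neg_re, (key ω hω).2, neg_zero]
  rw [hx0, hy0, smul_zero, add_zero] at hxy
  exact sub_eq_zero.1 hxy

lemma wLim_of_normal (e : StrongDual ℂ X ≃ₗᵢ⋆[ℂ] N) {Λ : Type*} {U : Ultrafilter Λ} {y : Λ → N}
    {n : N} {R : ℝ} (hR : ∀ᶠ l in (U : Filter Λ), ‖y l‖ ≤ R)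
    (h : ∀ ω : N →ₗ[ℂ] ℂ, IsNormalPosFunctional ω → Tendsto (fun l => ω (y l)) U (𝓝 (ω n))) :
    WLim e U y n := by
  obtain ⟨n', hn', -⟩ := WLim.exists e hR
  have : n' = n := eq_of_normal e fun ω hω =>
    tendsto_nhds_unique ((wCont_of_isNormalPosFunctional e hω).tendsto hR hn') (h ω hω)
  rwa [← this]

omit [PartialOrder N] [StarOrderedRing N] in
lemma eventually_norm_conjugate_le {Λ : Type*} {F : Filter Λ} {y : Λ → N} {R : ℝ}
    (hR : ∀ᶠ l in F, ‖y l‖ ≤ R) (c : N) :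
    ∀ᶠ l in F, ‖star c * y l * c‖ ≤ ‖star c‖ * R * ‖c‖ := by
  filter_upwards [hR] with l hl
  refine (norm_mul_le _ _).trans ?_
  gcongr
  exact (norm_mul_le _ _).trans (by gcongr)

lemma WLim.conjugate {e : StrongDual ℂ X ≃ₗᵢ⋆[ℂ] N} {Λ : Type*} {U : Ultrafilter Λ} {y : Λ → N}
    {n : N} {R : ℝ} (hR : ∀ᶠ l in (U : Filter Λ), ‖y l‖ ≤ R) (hn : WLim e U y n) (c : N) :
    WLim e U (fun l => Star.star c * y l * c) (Star.star c * n * c) := by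
  refine wLim_of_normal e (eventually_norm_conjugate_le hR c) fun ω hω => ?_
  have := (wCont_of_isNormalPosFunctional e (hω.conj c)).tendsto hR hn
  simpa only [conjFunctional_apply] using this

end WStar

section NormalMap

variable {M N : Type*} [CStarAlgebra M] [PartialOrder M] [StarOrderedRing M]
  [CStarAlgebra N] [PartialOrder N] [StarOrderedRing N]

omit [StarOrderedRing N] in
lemma continuous_of_normal {ω : N →ₗ[ℂ] ℂ} (hω : IsNormalPosFunctional ω) :
    @Continuous N ℂ (sigmaWeak N) _ ω := by
  let _ := sigmaWeak N
  exact (continuous_apply (⟨ω, hω⟩ : { f : N →ₗ[ℂ] ℂ // IsNormalPosFunctional f })).comp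
    (f := fun (m : N) (f : { f : N →ₗ[ℂ] ℂ // IsNormalPosFunctional f }) => f.1 m)
    continuous_induced_dom

lemma isNormalPosFunctional_comp {θ : M →ₗ[ℂ] N} (hθ : IsNormalMap θ)
    (hpos : ∀ a, 0 ≤ a → 0 ≤ θ a) {ω : N →ₗ[ℂ] ℂ} (hω : IsNormalPosFunctional ω) :
    IsNormalPosFunctional (ω ∘ₗ θ) := by
  refine ⟨pos_iff.1 fun a ha => hω.pos _ (hpos a ha), fun s x hs hd hx => ?_⟩
  have h1 : @Continuous M ℂ (sigmaWeak M) _ (ω ∘ₗ θ) :=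
    @Continuous.comp M N ℂ (sigmaWeak M) (sigmaWeak N) _ _ _ (continuous_of_normal hω) hθ
  have h2 : Tendsto (fun p : s => (p : M)) atTop (@nhds M (sigmaWeak M) x) := by
    rw [sigmaWeak, nhds_induced, tendsto_comap_iff, tendsto_pi_nhds]
    exact fun f => f.2.2 s x hs hd hx
  exact (@Continuous.tendsto M ℂ (sigmaWeak M) _ _ h1 x).comp h2

omit [StarOrderedRing M] [StarOrderedRing N] in
lemma isNormalMap_of_comp {θ : M →ₗ[ℂ] N}
    (h : ∀ ω : N →ₗ[ℂ] ℂ, IsNormalPosFunctional ω → IsNormalPosFunctional (ω ∘ₗ θ)) :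
    IsNormalMap θ := by
  let _ := sigmaWeak M
  refine continuous_induced_rng.2 (continuous_pi fun f => ?_)
  exact continuous_of_normal (h f.1 f.2)

end NormalMap

section MapWLim

variable {X Y : Type*} {M N : Type*} [NormedAddCommGroup X] [NormedSpace ℂ X] [CStarAlgebra M]
  [PartialOrder M] [StarOrderedRing M] [CompleteSpace X] [NormedAddCommGroup Y] [NormedSpace ℂ Y]
  [CStarAlgebra N] [PartialOrder N] [StarOrderedRing N] [CompleteSpace Y]

lemma WLim.map {e : StrongDual ℂ X ≃ₗᵢ⋆[ℂ] M} (e' : StrongDual ℂ Y ≃ₗᵢ⋆[ℂ] N) {θ : M →ₗ[ℂ] N}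
    (hθ : IsNormalMap θ) (hpos : ∀ a, 0 ≤ a → 0 ≤ θ a) (hnorm : ∀ a, ‖θ a‖ ≤ ‖a‖)
    {Λ : Type*} {U : Ultrafilter Λ} {y : Λ → M} {n : M} {R : ℝ}
    (hR : ∀ᶠ l in (U : Filter Λ), ‖y l‖ ≤ R) (hn : WLim e U y n) :
    WLim e' U (fun l => θ (y l)) (θ n) :=
  wLim_of_normal e' (hR.mono fun _ hl => (hnorm _).trans hl) fun _ hω =>
    (wCont_of_isNormalPosFunctional e (isNormalPosFunctional_comp hθ hpos hω)).tendsto hR hn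

end MapWLim

section Positive

variable {M N : Type*} [CStarAlgebra M] [PartialOrder M] [StarOrderedRing M]
  [CStarAlgebra N] [PartialOrder N] [StarOrderedRing N]

lemma isSelfAdjoint_map {θ : M →ₗ[ℂ] N} (hpos : ∀ a, 0 ≤ a → 0 ≤ θ a) {a : M}
    (ha : IsSelfAdjoint a) : IsSelfAdjoint (θ a) := by
  have h1 := hpos _ (sub_nonneg.2 (le_smul_one_of_norm_le ha le_rfl))
  have h2 := hpos _ (smul_nonneg (norm_nonneg a) (zero_le_one (α := M)))
  have h3 := (IsSelfAdjoint.of_nonneg h2).sub (IsSelfAdjoint.of_nonneg h1)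
  rwa [← map_sub, sub_sub_cancel] at h3

lemma map_star_of_nonneg {θ : M →ₗ[ℂ] N} (hpos : ∀ a, 0 ≤ a → 0 ≤ θ a) (a : M) :
    θ (star a) = star (θ a) := by
  obtain ⟨x, y, hx, hy, rfl⟩ := exists_re_im a
  simp [hx.star_eq, hy.star_eq, (isSelfAdjoint_map hpos hx).star_eq,
    (isSelfAdjoint_map hpos hy).star_eq]

omit [PartialOrder M] [StarOrderedRing M] in
lemma eq_zero_of_faithfulGNS {φ : N →ₗ[ℂ] M} (hφ : FaithfulGNS φ) {c : N} (hc : 0 ≤ c)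
    (h : ∀ z, φ (star z * c * z) = 0) : c = 0 := by
  have h1 : CFC.sqrt c * CFC.sqrt c = c := CFC.sqrt_mul_sqrt_self c hc
  have h2 : CFC.sqrt c = 0 := hφ _ fun z => by
    rw [star_mul, (IsSelfAdjoint.of_nonneg (CFC.sqrt_nonneg c)).star_eq, ← mul_assoc,
      mul_assoc (star z), h1, h z]
  rw [← h1, h2, mul_zero]

lemma nonneg_of_faithfulGNS {φ : N →ₗ[ℂ] M} (hφ : FaithfulGNS φ)
    (hpos : ∀ a, 0 ≤ a → 0 ≤ φ a) {n : N} (hn : IsSelfAdjoint n)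
    (h : ∀ z, 0 ≤ φ (star z * n * z)) : 0 ≤ n := by
  have h1 : n⁺ - n⁻ = n := CFC.posPart_sub_negPart n hn
  have h2 : n⁺ * n⁻ = 0 := CFC.posPart_mul_negPart n
  have h0 : 0 ≤ n⁻ := CFC.negPart_nonneg n
  have hsa : star n⁻ = n⁻ := (IsSelfAdjoint.of_nonneg h0).star_eq
  have h4 : n⁻ * n * n⁻ = - (n⁻ * n⁻ * n⁻) := by
    nth_rewrite 2 [← h1]
    rw [mul_sub, sub_mul, mul_assoc _ n⁺, h2, mul_zero, zero_sub]
  have h5 : 0 ≤ n⁻ * n⁻ * n⁻ := by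
    have := star_left_conjugate_nonneg h0 n⁻
    rwa [hsa] at this
  have h6 : n⁻ * n⁻ * n⁻ = 0 := eq_zero_of_faithfulGNS hφ h5 fun z => by
    refine le_antisymm ?_ (hpos _ (star_left_conjugate_nonneg h5 z))
    have := h (n⁻ * z)
    have h7 : star (n⁻ * z) * n * (n⁻ * z) = - (star z * (n⁻ * n⁻ * n⁻) * z) := by
      rw [star_mul, hsa, ← neg_mul, ← mul_neg, ← h4]
      simp only [mul_assoc]
    rwa [h7, map_neg, neg_nonneg] at this
  have h7 : star (n⁻ * n⁻) * (n⁻ * n⁻) = 0 := by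
    rw [star_mul, hsa, ← mul_assoc, h6, zero_mul]
  have h8 : star n⁻ * n⁻ = 0 := by
    rw [hsa]; exact CStarRing.star_mul_self_eq_zero_iff _ |>.1 h7
  rw [CStarRing.star_mul_self_eq_zero_iff] at h8
  rw [← h1, h8, sub_zero]
  exact CFC.posPart_nonneg n

end Positive

section Rel

variable {B M N : Type*} [CStarAlgebra B] [CStarAlgebra M] [CStarAlgebra N]

/-- `n` is the compression of `m` to the `L²`-space of `φ`. -/
def Rel (E : M →ₗ[ℂ] B) (φ : N →ₗ[ℂ] B) (emb : N →⋆ₐ[ℂ] M) (m : M) (n : N) : Prop :=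
  ∀ x : N, φ (star x * n * x) = E (star (emb x) * m * emb x)

variable {E : M →ₗ[ℂ] B} {φ : N →ₗ[ℂ] B} {emb : N →⋆ₐ[ℂ] M} {m m' : M} {n n' : N}

lemma Rel.polarization (h : Rel E φ emb m n) (x y : N) :
    φ (star x * n * y) = E (star (emb x) * m * emb y) := by
  have h1 := h (x + y)
  have h2 := h (x + Complex.I • y)
  have h3 := h x
  have h4 := h y
  simp only [map_add, map_smul, star_add, star_smul, add_mul, mul_add, smul_mul_assoc,
    mul_smul_comm, RCLike.star_def, Complex.conj_I] at h1 h2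
  simp only [smul_add, smul_smul, mul_neg, Complex.I_mul_I, neg_neg, one_smul] at h2
  linear_combination (norm := (match_scalars <;> ring_nf <;> simp [Complex.I_sq])) (1 / 2 : ℂ) • h1 - (Complex.I / 2) • h2
    + (Complex.I / 2 - 1 / 2 : ℂ) • h3 + (Complex.I / 2 - 1 / 2 : ℂ) • h4

lemma Rel.add (h : Rel E φ emb m n) (h' : Rel E φ emb m' n') :
    Rel E φ emb (m + m') (n + n') := fun x => by
  simp only [mul_add, add_mul, map_add, h x, h' x]

lemma Rel.smul (c : ℂ) (h : Rel E φ emb m n) : Rel E φ emb (c • m) (c • n) := fun x => by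
  simp only [mul_smul_comm, smul_mul_assoc, map_smul, h x]

lemma Rel.rsmul (c : ℝ) (h : Rel E φ emb m n) : Rel E φ emb (c • m) (c • n) := by
  simpa using h.smul (c : ℂ)

lemma Rel.sub (h : Rel E φ emb m n) (h' : Rel E φ emb m' n') :
    Rel E φ emb (m - m') (n - n') := fun x => by
  simp only [mul_sub, sub_mul, map_sub, h x, h' x]

lemma Rel.unique (hφ : FaithfulGNS φ) (h : Rel E φ emb m n) (h' : Rel E φ emb m n') : n = n' := by
  refine sub_eq_zero.1 (hφ _ fun x => ?_)
  rw [← mul_assoc, mul_sub, sub_mul, map_sub, h.polarization, h'.polarization, sub_self]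

end Rel

section Compression

variable {B M N : Type*} [CStarAlgebra B] [PartialOrder B] [StarOrderedRing B]
  [CStarAlgebra M] [PartialOrder M] [StarOrderedRing M]
  [CStarAlgebra N] [PartialOrder N] [StarOrderedRing N]

/-- Normal positive contractions `E` and `φ`, where `φ` is the restriction of `E` along `emb`
and has faithful GNS representation. -/
structure NormalPair (E : M →ₗ[ℂ] B) (φ : N →ₗ[ℂ] B) (emb : N →⋆ₐ[ℂ] M) : Prop where
  normal_left : IsNormalMap E
  normal_right : IsNormalMap φ
  nonneg_left : ∀ a, 0 ≤ a → 0 ≤ E a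
  nonneg_right : ∀ a, 0 ≤ a → 0 ≤ φ a
  norm_left : ∀ a, ‖E a‖ ≤ ‖a‖
  norm_right : ∀ a, ‖φ a‖ ≤ ‖a‖
  restrict : ∀ a, E (emb a) = φ a
  faithful : FaithfulGNS φ

variable {E : M →ₗ[ℂ] B} {φ : N →ₗ[ℂ] B} {emb : N →⋆ₐ[ℂ] M} {m : M} {n : N}

omit [StarOrderedRing B] [StarOrderedRing M] [StarOrderedRing N] in
lemma NormalPair.rel_emb (H : NormalPair E φ emb) (n : N) : Rel E φ emb (emb n) n := fun x => by
  rw [← map_star, ← map_mul, ← map_mul, H.restrict]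

omit [StarOrderedRing B] [StarOrderedRing M] [StarOrderedRing N] in
lemma NormalPair.rel_one (H : NormalPair E φ emb) : Rel E φ emb 1 1 := by
  simpa using H.rel_emb 1

lemma NormalPair.rel_star (H : NormalPair E φ emb) (h : Rel E φ emb m n) :
    Rel E φ emb (star m) (star n) := fun x => by
  have := congrArg star (h x)
  rw [← map_star_of_nonneg H.nonneg_left, ← map_star_of_nonneg H.nonneg_right] at this
  simpa [mul_assoc] using this

lemma NormalPair.isSelfAdjoint (H : NormalPair E φ emb) (h : Rel E φ emb m n)
    (hm : IsSelfAdjoint m) : IsSelfAdjoint n := by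
  have := H.rel_star h
  rw [hm.star_eq] at this
  exact this.unique H.faithful h

lemma NormalPair.nonneg (H : NormalPair E φ emb) (h : Rel E φ emb m n) (hm : 0 ≤ m) : 0 ≤ n :=
  nonneg_of_faithfulGNS H.faithful H.nonneg_right
    (H.isSelfAdjoint h (IsSelfAdjoint.of_nonneg hm)) fun z => by
      rw [h z]
      exact H.nonneg_left _ (star_left_conjugate_nonneg hm _)

lemma NormalPair.norm_le (H : NormalPair E φ emb) (h : Rel E φ emb m n)
    (hm : IsSelfAdjoint m) : ‖n‖ ≤ ‖m‖ := by
  refine norm_le_of_between (norm_nonneg _) ?_ ?_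
  · have := H.nonneg (h.add (H.rel_one.rsmul ‖m‖)) ?_
    · exact neg_le_iff_add_nonneg.2 this
    · have := le_smul_one_of_norm_le hm.neg (norm_neg m).le
      rwa [neg_le_iff_add_nonneg, add_comm] at this
  · exact sub_nonneg.1 (H.nonneg ((H.rel_one.rsmul ‖m‖).sub h)
      (sub_nonneg.2 (le_smul_one_of_norm_le hm le_rfl)))

variable {X Y Z : Type*} [NormedAddCommGroup X] [NormedSpace ℂ X] [CompleteSpace X]
  [NormedAddCommGroup Y] [NormedSpace ℂ Y] [CompleteSpace Y]
  [NormedAddCommGroup Z] [NormedSpace ℂ Z] [CompleteSpace Z]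
  {eM : StrongDual ℂ X ≃ₗᵢ⋆[ℂ] M} {eN : StrongDual ℂ Y ≃ₗᵢ⋆[ℂ] N}

lemma NormalPair.rel_of_wLim (H : NormalPair E φ emb) (eB : StrongDual ℂ Z ≃ₗᵢ⋆[ℂ] B)
    {Λ : Type*} {U : Ultrafilter Λ} {y : Λ → M} {z : Λ → N} {R S : ℝ}
    (h : ∀ᶠ l in (U : Filter Λ), Rel E φ emb (y l) (z l))
    (hR : ∀ᶠ l in (U : Filter Λ), ‖y l‖ ≤ R) (hS : ∀ᶠ l in (U : Filter Λ), ‖z l‖ ≤ S)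
    (hy : WLim eM U y m) (hz : WLim eN U z n) : Rel E φ emb m n := fun x => by
  have h1 := (hz.conjugate hS x).map eB H.normal_right H.nonneg_right H.norm_right
    (eventually_norm_conjugate_le hS x)
  have h2 := (hy.conjugate hR (emb x)).map eB H.normal_left H.nonneg_left H.norm_left
    (eventually_norm_conjugate_le hR (emb x))
  exact h1.unique (h2.congr' (h.mono fun l hl => (hl x).symm))

lemma NormalPair.exists_rel_of_wLim (H : NormalPair E φ emb) (eB : StrongDual ℂ Z ≃ₗᵢ⋆[ℂ] B)
    (eN : StrongDual ℂ Y ≃ₗᵢ⋆[ℂ] N) {Λ : Type*} {U : Ultrafilter Λ} {y : Λ → M} {R : ℝ}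
    (h : ∀ᶠ l in (U : Filter Λ), IsSelfAdjoint (y l) ∧ ∃ n, Rel E φ emb (y l) n)
    (hR : ∀ᶠ l in (U : Filter Λ), ‖y l‖ ≤ R) (hy : WLim eM U y m) :
    ∃ n, Rel E φ emb m n := by
  classical
  let z : Λ → N := fun l => if h : ∃ n, Rel E φ emb (y l) n then h.choose else 0
  have hz : ∀ᶠ l in (U : Filter Λ), Rel E φ emb (y l) (z l) := by
    filter_upwards [h] with l hl
    simp only [z, dif_pos hl.2]
    exact hl.2.choose_spec
  have hS : ∀ᶠ l in (U : Filter Λ), ‖z l‖ ≤ R := by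
    filter_upwards [h, hz, hR] with l h1 h2 h3 using (H.norm_le h2 h1.1).trans h3
  obtain ⟨n, hn, -⟩ := WLim.exists eN hS
  exact ⟨n, H.rel_of_wLim eB hz hR hS hy hn⟩

omit [PartialOrder M] [StarOrderedRing M] [CompleteSpace X] in
lemma wLim_of_tendsto (e : StrongDual ℂ X ≃ₗᵢ⋆[ℂ] M) {Λ : Type*} {U : Ultrafilter Λ} {y : Λ → M}
    (h : Tendsto y U (𝓝 m)) : WLim e U y m := fun x => by
  have h1 : Tendsto (fun l => e.symm (y l)) U (𝓝 (e.symm m)) :=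
    (e.symm.continuous.tendsto m).comp h
  exact ((ContinuousLinearMap.apply ℂ ℂ x).continuous.tendsto _).comp h1

lemma NormalPair.exists_separation_radius (H : NormalPair E φ emb)
    (eB : StrongDual ℂ Z ≃ₗᵢ⋆[ℂ] B) (eN : StrongDual ℂ Y ≃ₗᵢ⋆[ℂ] N)
    (eM : StrongDual ℂ X ≃ₗᵢ⋆[ℂ] M) (hm : IsSelfAdjoint m) (h : ¬ ∃ n, Rel E φ emb m n) :
    ∃ δ : ℝ, 0 < δ ∧ ∀ v, IsSelfAdjoint v → ‖v‖ ≤ 1 → ¬ ∃ n, Rel E φ emb (m - δ • v) n := by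
  by_contra! hcon
  have h1 : ∀ k : ℕ, ∃ v, IsSelfAdjoint v ∧ ‖v‖ ≤ 1 ∧
      ∃ n, Rel E φ emb (m - (1 / ((k : ℝ) + 1)) • v) n := fun k => hcon _ (by positivity)
  choose v hv hv1 hn using h1
  refine h (H.exists_rel_of_wLim eB eN (U := hyperfilter ℕ)
    (y := fun k => m - (1 / ((k : ℝ) + 1)) • v k) (R := ‖m‖ + 1)
    (Eventually.of_forall fun k => ⟨hm.sub ((IsSelfAdjoint.all _).smul (hv k)), hn k⟩)
    (Eventually.of_forall fun k => ?_) (wLim_of_tendsto eM ?_))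
  · refine (norm_sub_le _ _).trans (add_le_add_right ?_ _)
    rw [norm_smul, Real.norm_of_nonneg (by positivity)]
    refine mul_le_one₀ ?_ (norm_nonneg _) (hv1 k)
    rw [div_le_one (by positivity)]
    linarith [(Nat.cast_nonneg k : (0 : ℝ) ≤ k)]
  · have h2 : Tendsto (fun k : ℕ => (1 / ((k : ℝ) + 1)) • v k) atTop (𝓝 0) := by
      rw [tendsto_zero_iff_norm_tendsto_zero]
      refine squeeze_zero (fun _ => norm_nonneg _) (fun k => ?_)
        tendsto_one_div_add_atTop_nhds_zero_nat
      rw [norm_smul, Real.norm_of_nonneg (by positivity)]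
      exact mul_le_of_le_one_right (by positivity) (hv1 k)
    have h3 := h2.const_sub m
    rw [sub_zero] at h3
    exact h3.mono_left (Nat.hyperfilter_le_atTop)

end Compression

section Sums

variable {X : Type*} {M : Type u} [NormedAddCommGroup X] [NormedSpace ℂ X] [CStarAlgebra M]
  [PartialOrder M] [StarOrderedRing M] [CompleteSpace X]

lemma Pos.abs_re_le {ω : M →ₗ[ℂ] ℂ} (h : Pos ω) {v : M} (hv : IsSelfAdjoint v) :
    |(ω v).re| ≤ ‖v‖ * (ω 1).re := by
  have h1 := h.re_mono (le_smul_one_of_norm_le hv le_rfl)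
  have h2 := h.re_mono (le_smul_one_of_norm_le hv.neg (norm_neg v).le)
  rw [← Complex.coe_smul, map_smul, smul_eq_mul, Complex.re_ofReal_mul] at h1 h2
  rw [map_neg, Complex.neg_re] at h2
  exact abs_le.2 ⟨by linarith, h1⟩

lemma Pos.norm_le {ω : M →ₗ[ℂ] ℂ} (h : Pos ω) (y : M) : ‖ω y‖ ≤ 2 * (ω 1).re * ‖y‖ := by
  refine norm_le_of_norm_le_selfAdjoint ω (h.re_nonneg zero_le_one) (fun v hv => ?_) y
  have h1 : ω v = ((ω v).re : ℂ) := Complex.ext rfl (h.im_eq_zero hv)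
  rw [h1, Complex.norm_real, mul_comm]
  exact h.abs_re_le hv

lemma exists_normal_hasSum (e : StrongDual ℂ X ≃ₗᵢ⋆[ℂ] M) {J : Type*} {ω : J → M →ₗ[ℂ] ℂ}
    (hω : ∀ j, IsNormalPosFunctional (ω j)) (h1 : ∀ j, (ω j 1).re ≤ 1) {c : J → ℝ}
    (hc : ∀ j, 0 ≤ c j) (hs : Summable c) :
    ∃ P : M →ₗ[ℂ] ℂ, IsNormalPosFunctional P ∧ ∀ y, HasSum (fun j => (c j : ℂ) * ω j y) (P y) := by
  have hb : ∀ (y : M) j, ‖(c j : ℂ) * ω j y‖ ≤ c j * (2 * ‖y‖) := by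
    intro y j
    rw [norm_mul, Complex.norm_real, Real.norm_of_nonneg (hc j)]
    refine mul_le_mul_of_nonneg_left (((hω j).pos.norm_le y).trans ?_) (hc j)
    nlinarith [h1 j, norm_nonneg y]
  have hsum : ∀ y, Summable fun j => (c j : ℂ) * ω j y := fun y =>
    Summable.of_norm_bounded (hs.mul_right _) (hb y)
  let P : M →ₗ[ℂ] ℂ :=
    { toFun := fun y => ∑' j, (c j : ℂ) * ω j y
      map_add' := fun x y => by
        simp only [map_add, mul_add]
        exact (hsum x).tsum_add (hsum y)
      map_smul' := fun r x => by
        simp only [map_smul, smul_eq_mul, RingHom.id_apply, mul_left_comm _ r]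
        exact tsum_mul_left }
  have hP : WCont e P := by
    intro U n R hR hn
    refine tendsto_tsum_of_dominated_convergence (bound := fun j => c j * (2 * R))
      (hs.mul_right _) (fun j => ?_) ?_
    · exact ((wCont_of_isNormalPosFunctional e (hω j)).tendsto hR hn).const_mul _
    · filter_upwards [hR] with z hz j
      refine (hb z j).trans (mul_le_mul_of_nonneg_left ?_ (hc j))
      linarith
  refine ⟨P, hP.isNormalPosFunctional fun a ha => ?_, fun y => (hsum y).hasSum⟩
  exact tsum_nonneg fun j => mul_nonneg (by exact_mod_cast hc j) ((hω j).pos a ha)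

end Sums

section Existence

variable {B N : Type*} {M : Type u} [CStarAlgebra B] [PartialOrder B] [StarOrderedRing B]
  [CStarAlgebra M] [PartialOrder M] [StarOrderedRing M]
  [CStarAlgebra N] [PartialOrder N] [StarOrderedRing N]
  {E : M →ₗ[ℂ] B} {φ : N →ₗ[ℂ] B} {emb : N →⋆ₐ[ℂ] M} {m : M} {n : N}
  {X Y Z : Type*} [NormedAddCommGroup X] [NormedSpace ℂ X] [CompleteSpace X]
  [NormedAddCommGroup Y] [NormedSpace ℂ Y] [CompleteSpace Y]
  [NormedAddCommGroup Z] [NormedSpace ℂ Z] [CompleteSpace Z]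

/-- The restrictions to the self-adjoint part of the normal positive functionals of norm at
most one. -/
def normalStates (M : Type u) [CStarAlgebra M] [PartialOrder M] :
    Set (selfAdjoint M →ₗ[ℝ] ℝ) :=
  {w | ∃ ω : M →ₗ[ℂ] ℂ, IsNormalPosFunctional ω ∧ (ω 1).re ≤ 1 ∧ ∀ v, w v = (ω v).re}

/-- The real part of a functional on the self-adjoint part. -/
def reFunctional (ω : M →ₗ[ℂ] ℂ) : selfAdjoint M →ₗ[ℝ] ℝ where
  toFun v := (ω v).re
  map_add' v w := by simp
  map_smul' r v := by simp

lemma abs_le_of_mem_normalStates {w : selfAdjoint M →ₗ[ℝ] ℝ} (hw : w ∈ normalStates M)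
    (v : selfAdjoint M) : |w v| ≤ ‖v‖ := by
  obtain ⟨ω, hω, h1, h⟩ := hw
  rw [h]
  refine (hω.pos.abs_re_le v.2).trans ?_
  exact mul_le_of_le_one_right (norm_nonneg _) h1

lemma re_le_of_normalStates {v : M} (hv : IsSelfAdjoint v) {r : ℝ}
    (h : ∀ ω : M →ₗ[ℂ] ℂ, IsNormalPosFunctional ω → (ω 1).re ≤ 1 → (ω v).re ≤ r)
    {ω : M →ₗ[ℂ] ℂ} (hω : IsNormalPosFunctional ω) : (ω v).re ≤ r * (ω 1).re := by
  rcases (hω.pos.re_nonneg zero_le_one).eq_or_lt with h0 | h0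
  · have := hω.pos.abs_re_le hv
    rw [← h0, mul_zero] at this ⊢
    exact (le_abs_self _).trans this
  · have := h _ (hω.smul (inv_nonneg.2 h0.le)) (by
      rw [LinearMap.smul_apply, smul_eq_mul, Complex.re_ofReal_mul, inv_mul_cancel₀ h0.ne'])
    rw [LinearMap.smul_apply, smul_eq_mul, Complex.re_ofReal_mul, inv_mul_le_iff₀ h0] at this
    rwa [mul_comm]

lemma norm_le_of_normalStates (e : StrongDual ℂ X ≃ₗᵢ⋆[ℂ] M) (v : selfAdjoint M) {r : ℝ}
    (hr : 0 ≤ r) (h : ∀ w ∈ normalStates M, |w v| ≤ r) : ‖v‖ ≤ r := by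
  have h1 : ∀ ω : M →ₗ[ℂ] ℂ, IsNormalPosFunctional ω → (ω 1).re ≤ 1 → |(ω v).re| ≤ r :=
    fun ω hω hω1 => h (reFunctional ω) ⟨ω, hω, hω1, fun _ => rfl⟩
  refine norm_le_of_between (a := (v : M)) hr ?_ ?_
  · rw [neg_le_iff_add_nonneg]
    refine nonneg_of_normal e (v.2.add (isSelfAdjoint_smul_one r)) fun ω hω => ?_
    have h2 := re_le_of_normalStates (v := -(v : M)) v.2.neg (r := r) (fun ω hω hω1 => by
      rw [map_neg, Complex.neg_re]; exact neg_le.1 (abs_le.1 (h1 ω hω hω1)).1) hω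
    rw [map_neg, Complex.neg_re] at h2
    rw [← Complex.coe_smul, map_add, map_smul, Complex.add_re, smul_eq_mul,
      Complex.re_ofReal_mul]
    linarith
  · rw [← sub_nonneg]
    refine nonneg_of_normal e ((isSelfAdjoint_smul_one r).sub v.2) fun ω hω => ?_
    have h2 := re_le_of_normalStates v.2 (r := r)
      (fun ω hω hω1 => (abs_le.1 (h1 ω hω hω1)).2) hω
    rw [← Complex.coe_smul, map_sub, map_smul, Complex.sub_re, smul_eq_mul,
      Complex.re_ofReal_mul]
    linarith

lemma NormalPair.exists_separating (H : NormalPair E φ emb)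
    (eB : StrongDual ℂ Z ≃ₗᵢ⋆[ℂ] B) (eN : StrongDual ℂ Y ≃ₗᵢ⋆[ℂ] N)
    (eM : StrongDual ℂ X ≃ₗᵢ⋆[ℂ] M) (hm : IsSelfAdjoint m) (h : ¬ ∃ n, Rel E φ emb m n) :
    ∃ P Q : M →ₗ[ℂ] ℂ, IsNormalPosFunctional P ∧ IsNormalPosFunctional Q ∧ ∃ δ : ℝ, δ ≠ 0 ∧
      ∀ v, IsSelfAdjoint v → (∃ n, Rel E φ emb (m - δ • v) n) → 1 ≤ (P v - Q v).re := by
  obtain ⟨δ, hδ, hball⟩ := H.exists_separation_radius eB eN eM hm h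
  obtain ⟨J, w, a, hw, ha, hsep⟩ := exists_summable_separation (V := selfAdjoint M)
    (Ω := normalStates M) (C := {v | ∃ n, Rel E φ emb (m - δ • (v : M)) n})
    (by
      rintro v ⟨n, hn⟩ v' ⟨n', hn'⟩ s t hs ht hst
      refine ⟨s • n + t • n', ?_⟩
      have h1 : m - δ • ((s • v + t • v' : selfAdjoint M) : M)
          = s • (m - δ • (v : M)) + t • (m - δ • (v' : M)) := by
        have : m = (s + t) • m := by rw [hst, one_smul]
        nth_rewrite 1 [this]
        simp only [AddSubgroup.coe_add, selfAdjoint.val_smul]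
        module
      rw [h1]
      exact (hn.rsmul s).add (hn'.rsmul t))
    (fun w hw v => abs_le_of_mem_normalStates hw v)
    (fun v r hr h => norm_le_of_normalStates eM v hr h)
    (by
      intro R U hU
      have hR : ∀ᶠ v : selfAdjoint M in (U : Filter (selfAdjoint M)), ‖(v : M)‖ ≤ R :=
        hU.mono fun v hv => hv.2
      obtain ⟨y, hy, -⟩ := WLim.exists eM hR
      have hysa := hy.isSelfAdjoint hR (Eventually.of_forall fun v => v.2)
      refine ⟨⟨y, hysa⟩, ?_, ?_⟩
      · refine H.exists_rel_of_wLim eB eN (U := U) (R := ‖m‖ + ‖δ‖ * R) ?_ ?_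
          ((WLim.const m).sub (hy.rsmul δ))
        · filter_upwards [hU] with v hv
          exact ⟨hm.sub ((IsSelfAdjoint.all _).smul v.2), hv.1⟩
        · filter_upwards [hR] with v hv
          refine (norm_sub_le _ _).trans ?_
          rw [norm_smul]
          gcongr
      · rintro w ⟨ω, hω, -, hwω⟩
        have := (wCont_of_isNormalPosFunctional eM hω).tendsto hR hy
        rw [funext hwω]
        exact (Complex.continuous_re.tendsto _).comp this)
    (by
      intro v hv
      by_contra! hle
      exact hball v v.2 hle hv)
  choose ω hω hω1 hwω using hw
  have hs1 : Summable fun j => (a j)⁺ := Summable.of_nonneg_of_le (fun j => posPart_nonneg _)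
    (fun j => by rw [← posPart_add_negPart]; simp) ha
  have hs2 : Summable fun j => (a j)⁻ := Summable.of_nonneg_of_le (fun j => negPart_nonneg _)
    (fun j => by rw [← posPart_add_negPart]; simp) ha
  obtain ⟨P, hP, hPs⟩ := exists_normal_hasSum eM hω hω1 (fun j => posPart_nonneg (a j)) hs1
  obtain ⟨Q, hQ, hQs⟩ := exists_normal_hasSum eM hω hω1 (fun j => negPart_nonneg (a j)) hs2
  refine ⟨P, Q, hP, hQ, δ, hδ.ne', fun v hv hn => ?_⟩
  have h1 := Complex.hasSum_re ((hPs v).sub (hQs v))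
  have h2 := hsep ⟨v, hv⟩ hn
  rw [← h1.tsum_eq]
  refine h2.trans_eq (tsum_congr fun j => ?_)
  rw [← sub_mul, ← Complex.ofReal_sub, posPart_sub_negPart, Complex.re_ofReal_mul, hwω]

theorem NormalPair.exists_rel (H : NormalPair E φ emb)
    (eB : StrongDual ℂ Z ≃ₗᵢ⋆[ℂ] B) (eN : StrongDual ℂ Y ≃ₗᵢ⋆[ℂ] N)
    (eM : StrongDual ℂ X ≃ₗᵢ⋆[ℂ] M) {S : StarSubalgebra ℂ M}
    (hS : ∀ a ∈ S, ∃ n, Rel E φ emb a n) (hd : @Dense M (sigmaWeak M) (S : Set M)) (m : M) :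
    ∃ n, Rel E φ emb m n := by
  suffices hsa : ∀ m, IsSelfAdjoint m → ∃ n, Rel E φ emb m n by
    obtain ⟨x, y, hx, hy, rfl⟩ := exists_re_im m
    obtain ⟨p, hp⟩ := hsa x hx
    obtain ⟨q, hq⟩ := hsa y hy
    exact ⟨_, hp.add (hq.smul _)⟩
  intro m hm
  by_contra hcon
  obtain ⟨P, Q, hP, hQ, δ, hδ, hsep⟩ := H.exists_separating eB eN eM hm hcon
  have hzero : ∀ d ∈ S, IsSelfAdjoint d → P d = Q d := by
    intro d hd hdsa
    have key : ∀ t : ℝ, 1 ≤ (P m - Q m).re * δ⁻¹ + t * (P d - Q d).re := by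
      intro t
      have h1 := hsep (δ⁻¹ • m + t • d) (((IsSelfAdjoint.all _).smul hm).add
        ((IsSelfAdjoint.all _).smul hdsa)) (by
          obtain ⟨n, hn⟩ := hS d hd
          refine ⟨(-(δ * t)) • n, ?_⟩
          have : m - δ • (δ⁻¹ • m + t • d) = (-(δ * t)) • d := by
            rw [smul_add, smul_inv_smul₀ hδ, smul_smul, neg_smul]; abel
          rw [this]
          exact hn.rsmul _)
      simp only [← Complex.coe_smul, map_add, map_smul, smul_eq_mul, Complex.sub_re,
        Complex.add_re, Complex.re_ofReal_mul] at h1 ⊢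
      linarith
    have h2 : (P d - Q d).re = 0 := by
      by_contra hne
      have := key (-((P m - Q m).re * δ⁻¹) / (P d - Q d).re)
      rw [div_mul_cancel₀ _ hne] at this
      linarith
    rw [Complex.sub_re, sub_eq_zero] at h2
    exact Complex.ext h2 (by rw [hP.pos.im_eq_zero hdsa, hQ.pos.im_eq_zero hdsa])
  have hPQ : ∀ a ∈ S, P a = Q a := by
    intro a ha
    have h1 := realPart_add_I_smul_imaginaryPart a
    have hre : (realPart a : M) ∈ S := by
      rw [realPart_apply_coe, ← Complex.coe_smul]
      exact S.smul_mem (add_mem ha (star_mem ha)) _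
    have him : (imaginaryPart a : M) ∈ S := by
      rw [imaginaryPart_apply_coe, ← Complex.coe_smul]
      exact S.smul_mem (S.smul_mem (sub_mem ha (star_mem ha)) _) _
    rw [← h1, map_add, map_add, map_smul, map_smul, hzero _ hre (realPart a).2,
      hzero _ him (imaginaryPart a).2]
  have hall : (P : M → ℂ) = Q := by
    let _ := sigmaWeak M
    exact (continuous_of_normal hP).ext_on (s := (S : Set M)) hd (continuous_of_normal hQ) hPQ
  have h1 := hsep (δ⁻¹ • m) ((IsSelfAdjoint.all _).smul hm) ⟨0, fun x => by
    rw [smul_inv_smul₀ hδ, sub_self]; simp⟩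
  rw [hall, sub_self] at h1
  simp at h1
  linarith

end Existence

section Words

variable {I : Type*} {B : Type*} [CStarAlgebra B] {A : I → Type*} [∀ i, CStarAlgebra (A i)]
  {M : Type*} [CStarAlgebra M]
  {jB : ∀ i, B →⋆ₐ[ℂ] A i} {φ : ∀ i, A i →ₗ[ℂ] B}
  {jC : B →⋆ₐ[ℂ] M} {emb : ∀ i, A i →⋆ₐ[ℂ] M} {E : M →ₗ[ℂ] B}

lemma _root_.IsCondExp.map_left_mul {N : Type*} [CStarAlgebra N] {j : B →⋆ₐ[ℂ] N} {F : N →ₗ[ℂ] B}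
    (h : IsCondExp j F) (b : B) (x : N) : F (j b * x) = b * F x := by
  simpa using h.bimodule b 1 x

lemma _root_.IsCondExp.map_mul_right {N : Type*} [CStarAlgebra N] {j : B →⋆ₐ[ℂ] N} {F : N →ₗ[ℂ] B}
    (h : IsCondExp j F) (x : N) (b : B) : F (x * j b) = F x * b := by
  simpa using h.bimodule 1 b x

lemma _root_.IsCondExp.map_centered {N : Type*} [CStarAlgebra N] {j : B →⋆ₐ[ℂ] N} {F : N →ₗ[ℂ] B}
    (h : IsCondExp j F) (x : N) : F (x - j (F x)) = 0 := by
  rw [map_sub, h.left_inverse, sub_self]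

/-- Alternating words in centered elements. -/
def Alternating (φ : ∀ i, A i →ₗ[ℂ] B) (l : List (Σ i, A i)) : Prop :=
  l.IsChain (fun p q => p.1 ≠ q.1) ∧ ∀ p ∈ l, φ p.1 p.2 = 0

/-- The product of the letters of a word. -/
def wordProd (emb : ∀ i, A i →⋆ₐ[ℂ] M) (l : List (Σ i, A i)) : M :=
  (l.map fun p => emb p.1 p.2).prod

@[simp] lemma wordProd_nil : wordProd emb [] = 1 := rfl

@[simp] lemma wordProd_cons (p : Σ i, A i) (l : List (Σ i, A i)) :
    wordProd emb (p :: l) = emb p.1 p.2 * wordProd emb l := by simp [wordProd]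

@[simp] lemma wordProd_append (l l' : List (Σ i, A i)) :
    wordProd emb (l ++ l') = wordProd emb l * wordProd emb l' := by simp [wordProd]

lemma Alternating.nil : Alternating φ [] := ⟨.nil, by simp⟩

lemma Alternating.cons {l : List (Σ i, A i)} (h : Alternating φ l) {i : I} {a : A i}
    (ha : φ i a = 0) (hi : ∀ p ∈ l.head?, i ≠ p.1) : Alternating φ (⟨i, a⟩ :: l) :=
  ⟨List.isChain_cons.2 ⟨hi, h.1⟩, by
    rintro p (_ | ⟨_, hp⟩)
    · exact ha
    · exact h.2 p hp⟩

lemma Alternating.of_cons {p : Σ i, A i} {l : List (Σ i, A i)} (h : Alternating φ (p :: l)) :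
    φ p.1 p.2 = 0 ∧ (∀ q ∈ l.head?, p.1 ≠ q.1) ∧ Alternating φ l :=
  ⟨h.2 p (by simp), (List.isChain_cons.1 h.1).1, (List.isChain_cons.1 h.1).2,
    fun q hq => h.2 q (by simp [hq])⟩

lemma Alternating.concat {l : List (Σ i, A i)} (h : Alternating φ l) {i : I} {a : A i}
    (ha : φ i a = 0) (hi : ∀ p ∈ l.getLast?, p.1 ≠ i) : Alternating φ (l ++ [⟨i, a⟩]) :=
  ⟨List.isChain_append.2 ⟨h.1, .singleton _, fun p hp q hq => by
    simp only [List.head?_cons, Option.mem_def, Option.some.injEq] at hq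
    subst hq
    exact hi p hp⟩, fun p hp => by
    rcases List.mem_append.1 hp with hp | hp
    · exact h.2 p hp
    · rw [List.mem_singleton] at hp
      subst hp
      exact ha⟩

lemma Alternating.of_concat {p : Σ i, A i} {l : List (Σ i, A i)}
    (h : Alternating φ (l ++ [p])) : (∀ q ∈ l.getLast?, q.1 ≠ p.1) ∧ Alternating φ l :=
  ⟨fun q hq => (List.isChain_append.1 h.1).2.2 q hq p (by simp),
    (List.isChain_append.1 h.1).1, fun q hq => h.2 q (by simp [hq])⟩

/-- Freeness of the family of subalgebras with respect to `E`, in terms of words. -/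
def FreeWords (φ : ∀ i, A i →ₗ[ℂ] B) (emb : ∀ i, A i →⋆ₐ[ℂ] M) (E : M →ₗ[ℂ] B) : Prop :=
  ∀ l, Alternating φ l → l ≠ [] → E (wordProd emb l) = 0

lemma alternating_ofFn {n : ℕ} {ι : Fin (n + 1) → I} (hι : ∀ k : Fin n, ι k.castSucc ≠ ι k.succ)
    {a : (j : Fin (n + 1)) → A (ι j)} (ha : ∀ j, φ (ι j) (a j) = 0) :
    Alternating φ (List.ofFn fun j => (⟨ι j, a j⟩ : Σ i, A i)) :=
  ⟨List.isChain_ofFn.2 fun k hk => hι ⟨k, by omega⟩, List.forall_mem_ofFn_iff.2 ha⟩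

lemma wordProd_ofFn {n : ℕ} {ι : Fin n → I} (a : (j : Fin n) → A (ι j)) :
    wordProd emb (List.ofFn fun j => (⟨ι j, a j⟩ : Σ i, A i))
      = (List.ofFn fun j => emb (ι j) (a j)).prod := by
  rw [wordProd, List.map_ofFn]
  rfl

lemma freeWords_of_free (h : ∀ (n : ℕ) (ι : Fin (n + 1) → I),
    (∀ k : Fin n, ι k.castSucc ≠ ι k.succ) → ∀ a : (j : Fin (n + 1)) → A (ι j),
      (∀ j, φ (ι j) (a j) = 0) → E ((List.ofFn fun j => emb (ι j) (a j)).prod) = 0) :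
    FreeWords φ emb E := by
  refine List.forall_iff_forall_tuple.2 fun n f hf hne => ?_
  cases n with
  | zero => simp at hne
  | succ n =>
    rw [show f = fun j => (⟨(f j).1, (f j).2⟩ : Σ i, A i) from rfl, wordProd_ofFn]
    exact h n _ (fun k => List.isChain_ofFn.1 hf.1 k (by omega)) _
      (List.forall_mem_ofFn_iff.1 hf.2)

variable (hce : ∀ i, IsCondExp (jB i) (φ i)) (hE : IsCondExp jC E)
  (hcompat : ∀ i, (emb i).comp (jB i) = jC) (hfree : FreeWords φ emb E)

include hce hcompat in
lemma emb_eq_centered_add (i : I) (q : A i) :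
    ∃ q' : A i, φ i q' = 0 ∧ emb i q = emb i q' + jC (φ i q) := by
  refine ⟨q - jB i (φ i q), (hce i).map_centered q, ?_⟩
  rw [← hcompat i, map_sub, StarAlgHom.comp_apply, sub_add_cancel]

include hce hE hcompat hfree

lemma map_word_mul_of_getLast_ne {l : List (Σ i, A i)} (hl : Alternating φ l) (hne : l ≠ [])
    {i : I} (hi : ∀ p ∈ l.getLast?, p.1 ≠ i) (q : A i) : E (wordProd emb l * emb i q) = 0 := by
  obtain ⟨q', hq', hq⟩ := emb_eq_centered_add hce hcompat i q
  have := hfree _ (hl.concat hq' hi) (by simp)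
  rw [wordProd_append, wordProd_cons, wordProd_nil, mul_one] at this
  rw [hq, mul_add, map_add, this, hE.map_mul_right, hfree l hl hne, zero_mul, add_zero]

lemma map_word_mul {l : List (Σ i, A i)} (hl : Alternating φ l) (hne : l ≠ [])
    {i : I} (hi : ∀ a : A i, l ≠ [⟨i, a⟩]) (q : A i) : E (wordProd emb l * emb i q) = 0 := by
  obtain rfl | ⟨l, ⟨j, a⟩, rfl⟩ := l.eq_nil_or_concat'
  · exact absurd rfl hne
  by_cases hij : j = i
  · subst hij
    have h := hl.of_concat
    have hl' : l ≠ [] := by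
      rintro rfl
      exact hi a rfl
    have := map_word_mul_of_getLast_ne hce hE hcompat hfree h.2 hl' h.1 (a * q)
    simpa [mul_assoc] using this
  · exact map_word_mul_of_getLast_ne hce hE hcompat hfree hl hne (by simpa using hij) q

lemma map_mul_word_mul_of_head_ne {l : List (Σ i, A i)} (hl : Alternating φ l) (hne : l ≠ [])
    {i : I} (hi : ∀ p ∈ l.head?, i ≠ p.1) (p q : A i) :
    E (emb i p * wordProd emb l * emb i q) = 0 := by
  obtain ⟨p', hp', hp⟩ := emb_eq_centered_add hce hcompat i p
  have h1 := map_word_mul hce hE hcompat hfree (hl.cons hp' hi) (by simp) (i := i)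
    (by simp [hne]) q
  rw [wordProd_cons] at h1
  have h2 := map_word_mul hce hE hcompat hfree hl hne (i := i) (by
    rintro a rfl
    exact hi ⟨i, a⟩ (by simp) rfl) q
  rw [hp, add_mul, add_mul, map_add, h1, mul_assoc, hE.map_left_mul, h2, mul_zero, add_zero]

lemma map_mul_word_mul {l : List (Σ i, A i)} (hl : Alternating φ l) (hne : l ≠ [])
    {i : I} (hi : ∀ a : A i, l ≠ [⟨i, a⟩]) (p q : A i) :
    E (emb i p * wordProd emb l * emb i q) = 0 := by
  obtain _ | ⟨⟨j, a⟩, l⟩ := l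
  · exact absurd rfl hne
  by_cases hij : j = i
  · subst hij
    have h := hl.of_cons
    have hl' : l ≠ [] := by
      rintro rfl
      exact hi a rfl
    have := map_mul_word_mul_of_head_ne hce hE hcompat hfree h.2.2 hl' h.2.1 (p * a) q
    simpa [mul_assoc] using this
  · exact map_mul_word_mul_of_head_ne hce hE hcompat hfree hl hne (by simpa using Ne.symm hij) p q

lemma rel_word_zero {l : List (Σ i, A i)} (hl : Alternating φ l) (hne : l ≠ [])
    {i : I} (hi : ∀ a : A i, l ≠ [⟨i, a⟩]) : Rel E (φ i) (emb i) (wordProd emb l) 0 := fun x => by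
  rw [← map_star, map_mul_word_mul hce hE hcompat hfree hl hne hi]
  simp

omit hE hfree in
lemma emb_mul_mem_span {W : Submodule ℂ M}
    (hW : ∀ b l, Alternating φ l → jC b * wordProd emb l ∈ W) {l : List (Σ i, A i)}
    (hl : Alternating φ l) {i : I} (hi : ∀ p ∈ l.head?, i ≠ p.1) (a : A i) :
    emb i a * wordProd emb l ∈ W := by
  obtain ⟨a', ha', ha⟩ := emb_eq_centered_add hce hcompat i a
  have := hW 1 _ (hl.cons ha' hi)
  rw [wordProd_cons, map_one, one_mul] at this
  rw [ha, add_mul]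
  exact W.add_mem this (hW _ l hl)

omit hE hfree in
lemma adjoin_le_of_words {W : Submodule ℂ M}
    (hW : ∀ b l, Alternating φ l → jC b * wordProd emb l ∈ W) {x : M}
    (hx : x ∈ StarAlgebra.adjoin ℂ (⋃ i, Set.range (emb i))) : x ∈ W := by
  let W' := Submodule.span ℂ {x | ∃ b l, Alternating φ l ∧ x = jC b * wordProd emb l}
  have hW' : ∀ b l, Alternating φ l → jC b * wordProd emb l ∈ W' := fun b l hl =>
    Submodule.subset_span ⟨b, l, hl, rfl⟩
  have hgen : ∀ i (q : A i), ∀ w ∈ W', emb i q * w ∈ W' := by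
    intro i q w hw
    induction hw using Submodule.span_induction with
    | zero => simp
    | add x y _ _ hx hy => rw [mul_add]; exact W'.add_mem hx hy
    | smul c x _ hx => rw [mul_smul_comm]; exact W'.smul_mem c hx
    | mem x hx =>
      obtain ⟨b, l, hl, rfl⟩ := hx
      have h1 : emb i q * (jC b * wordProd emb l) = emb i (q * jB i b) * wordProd emb l := by
        rw [← mul_assoc, ← hcompat i, StarAlgHom.comp_apply, map_mul]
      rw [h1]
      obtain _ | ⟨⟨j, a⟩, l⟩ := l
      · exact emb_mul_mem_span hce hcompat hW' hl (by simp) _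
      by_cases hij : j = i
      · subst hij
        rw [wordProd_cons, ← mul_assoc, ← map_mul]
        exact emb_mul_mem_span hce hcompat hW' hl.of_cons.2.2 hl.of_cons.2.1 _
      · exact emb_mul_mem_span hce hcompat hW' hl (by simpa using Ne.symm hij) _
  have hmul : (∀ w ∈ W', x * w ∈ W') ∧ ∀ w ∈ W', star x * w ∈ W' := by
    induction hx using StarAlgebra.adjoin_induction with
    | mem x hx =>
      obtain ⟨i, q, rfl⟩ := Set.mem_iUnion.1 hx
      exact ⟨hgen i q, by rw [← map_star]; exact hgen i _⟩
    | algebraMap r =>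
      refine ⟨fun w hw => ?_, fun w hw => ?_⟩
      · rw [← Algebra.smul_def]; exact W'.smul_mem _ hw
      · rw [← algebraMap_star_comm, ← Algebra.smul_def]; exact W'.smul_mem _ hw
    | add x y _ _ hx hy =>
      refine ⟨fun w hw => ?_, fun w hw => ?_⟩
      · rw [add_mul]; exact W'.add_mem (hx.1 w hw) (hy.1 w hw)
      · rw [star_add, add_mul]; exact W'.add_mem (hx.2 w hw) (hy.2 w hw)
    | mul x y _ _ hx hy =>
      refine ⟨fun w hw => ?_, fun w hw => ?_⟩
      · rw [mul_assoc]; exact hx.1 _ (hy.1 w hw)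
      · rw [star_mul, mul_assoc]; exact hy.2 _ (hx.2 w hw)
    | star x _ hx => exact ⟨hx.2, by rw [star_star]; exact hx.1⟩
  have h1 : (1 : M) ∈ W' := by simpa using hW' 1 [] Alternating.nil
  have h2 := hmul.1 1 h1
  rw [mul_one] at h2
  refine Submodule.span_le.2 ?_ h2
  rintro _ ⟨b, l, hl, rfl⟩
  exact hW b l hl

lemma exists_rel_of_mem_adjoin (hrestrict : ∀ i (a : A i), E (emb i a) = φ i a) (i₀ : I) {x : M}
    (hx : x ∈ StarAlgebra.adjoin ℂ (⋃ i, Set.range (emb i))) :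
    ∃ n, Rel E (φ i₀) (emb i₀) x n := by
  have hemb : ∀ a, Rel E (φ i₀) (emb i₀) (emb i₀ a) a := fun a x => by
    rw [← map_star, ← map_mul, ← map_mul, hrestrict]
  let W : Submodule ℂ M :=
    { carrier := {m | ∃ n, Rel E (φ i₀) (emb i₀) m n}
      add_mem' := by
        rintro _ _ ⟨n, hn⟩ ⟨n', hn'⟩
        exact ⟨_, hn.add hn'⟩
      zero_mem' := ⟨0, by simpa using hemb 0⟩
      smul_mem' := by
        rintro c _ ⟨n, hn⟩
        exact ⟨_, hn.smul c⟩ }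
  refine adjoin_le_of_words (W := W) hce hcompat (fun b l hl => ?_) hx
  obtain _ | ⟨⟨j, a⟩, l⟩ := l
  · refine ⟨jB i₀ b, ?_⟩
    rw [wordProd_nil, mul_one, ← hcompat i₀]
    exact hemb _
  have h1 : jC b * wordProd emb (⟨j, a⟩ :: l) = wordProd emb (⟨j, jB j b * a⟩ :: l) := by
    rw [wordProd_cons, wordProd_cons, ← mul_assoc, map_mul, ← hcompat j]
    rfl
  have h2 : Alternating φ (⟨j, jB j b * a⟩ :: l) :=
    hl.of_cons.2.2.cons (by rw [(hce j).map_left_mul, hl.of_cons.1, mul_zero]) hl.of_cons.2.1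
  rw [h1]
  by_cases hs : ∃ a' : A i₀, (⟨j, jB j b * a⟩ :: l : List (Σ i, A i)) = [⟨i₀, a'⟩]
  · obtain ⟨a', ha'⟩ := hs
    refine ⟨a', ?_⟩
    rw [ha', wordProd_cons, wordProd_nil, mul_one]
    exact hemb a'
  · push Not at hs
    exact ⟨0, rel_word_zero hce hE hcompat hfree h2 (by simp) hs⟩

end Words

section Conclusion

variable {B M N : Type*} [CStarAlgebra B] [PartialOrder B] [StarOrderedRing B]
  [CStarAlgebra M] [PartialOrder M] [StarOrderedRing M]
  [CStarAlgebra N] [PartialOrder N] [StarOrderedRing N]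
  {E : M →ₗ[ℂ] B} {φ : N →ₗ[ℂ] B} {emb : N →⋆ₐ[ℂ] M}

lemma _root_.IsCondExp.map_nonneg {j : B →⋆ₐ[ℂ] N} {F : N →ₗ[ℂ] B} (h : IsCondExp j F) (a : N)
    (ha : 0 ≤ a) : 0 ≤ F a := by
  obtain ⟨b, rfl⟩ := CStarAlgebra.nonneg_iff_eq_star_mul_self.1 ha
  obtain ⟨c, hc⟩ := h.positive b
  rw [hc]
  exact star_mul_self_nonneg c

omit [PartialOrder B] [StarOrderedRing B] [PartialOrder M] [StarOrderedRing M]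
  [PartialOrder N] [StarOrderedRing N] in
omit [PartialOrder B] [StarOrderedRing B] [PartialOrder M] [StarOrderedRing M]
  [PartialOrder N] [StarOrderedRing N] in
lemma exists_linear_of_rel (hφ : FaithfulGNS φ) (h : ∀ m, ∃ n, Rel E φ emb m n) :
    ∃ Φ : M →ₗ[ℂ] N, ∀ m, Rel E φ emb m (Φ m) := by
  choose Φ hΦ using h
  exact ⟨{  toFun := Φ
            map_add' := fun x y => (hΦ _).unique hφ ((hΦ x).add (hΦ y))
            map_smul' := fun c x => (hΦ _).unique hφ ((hΦ x).smul c) }, hΦ⟩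

variable (H : NormalPair E φ emb) {Φ : M →ₗ[ℂ] N} (hΦ : ∀ m, Rel E φ emb m (Φ m))
include H hΦ

omit [StarOrderedRing B] [StarOrderedRing M] [StarOrderedRing N] in
omit [StarOrderedRing B] [StarOrderedRing M] [StarOrderedRing N] in
lemma NormalPair.map_emb (a : N) : Φ (emb a) = a := (hΦ _).unique H.faithful (H.rel_emb a)

omit [StarOrderedRing B] [StarOrderedRing M] [StarOrderedRing N] in
omit [StarOrderedRing B] [StarOrderedRing M] [StarOrderedRing N] in
lemma NormalPair.map_bimodule (a b : N) (m : M) : Φ (emb a * m * emb b) = a * Φ m * b :=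
  (hΦ _).unique H.faithful fun x => by
    have := (hΦ m).polarization (star a * x) (b * x)
    simpa [mul_assoc, ← map_star] using this

lemma NormalPair.map_nonneg (a : M) (ha : 0 ≤ a) : 0 ≤ Φ a := H.nonneg (hΦ a) ha

lemma NormalPair.star_mul_self_map_le (m : M) : star (Φ m) * Φ m ≤ Φ (star m * m) := by
  have h1 := H.map_nonneg hΦ _ (star_mul_self_nonneg (m - emb (Φ m)))
  have h2 : Φ (star (emb (Φ m)) * m) = star (Φ m) * Φ m := by
    have := H.map_bimodule hΦ (star (Φ m)) 1 m
    rw [← map_star]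
    simpa only [map_one, mul_one] using this
  have h3 : Φ (star m * emb (Φ m)) = star (Φ m) * Φ m := by
    have := H.map_bimodule hΦ 1 (Φ m) (star m)
    rw [map_star_of_nonneg (H.map_nonneg hΦ)] at this
    simpa using this
  have h4 : Φ (star (emb (Φ m)) * emb (Φ m)) = star (Φ m) * Φ m := by
    rw [← map_star, ← map_mul, H.map_emb hΦ]
  rw [star_sub, sub_mul, mul_sub, mul_sub, map_sub, map_sub, map_sub, h2, h3, h4] at h1
  simpa using h1

lemma NormalPair.norm_map_le (m : M) : ‖Φ m‖ ≤ ‖m‖ := by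
  have h1 := CStarAlgebra.norm_le_norm_of_nonneg_of_le (star_mul_self_nonneg (Φ m))
    (H.star_mul_self_map_le hΦ m)
  have h2 := H.norm_le (hΦ (star m * m)) (IsSelfAdjoint.star_mul_self m)
  rw [CStarRing.norm_star_mul_self] at h1 h2
  exact (mul_self_le_mul_self_iff (norm_nonneg _) (norm_nonneg _)).2 (h1.trans h2)

lemma NormalPair.isCondExp (hemb : Function.Injective emb) : IsCondExp emb Φ where
  injective := hemb
  left_inverse := H.map_emb hΦ
  bimodule := H.map_bimodule hΦ
  positive a := CStarAlgebra.nonneg_iff_eq_star_mul_self.1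
    (H.map_nonneg hΦ _ (star_mul_self_nonneg a))
  contractive := H.norm_map_le hΦ

lemma NormalPair.isNormalMap {X Y Z : Type*} [NormedAddCommGroup X] [NormedSpace ℂ X]
    [CompleteSpace X] [NormedAddCommGroup Y] [NormedSpace ℂ Y] [CompleteSpace Y]
    [NormedAddCommGroup Z] [NormedSpace ℂ Z] [CompleteSpace Z]
    (eM : StrongDual ℂ X ≃ₗᵢ⋆[ℂ] M) (eN : StrongDual ℂ Y ≃ₗᵢ⋆[ℂ] N)
    (eB : StrongDual ℂ Z ≃ₗᵢ⋆[ℂ] B) : IsNormalMap Φ := by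
  refine isNormalMap_of_comp fun ω hω =>
    ⟨pos_iff.1 fun a ha => hω.pos _ (H.map_nonneg hΦ a ha), fun s x hs _ hx => ?_⟩
  rw [tendsto_iff_ultrafilter]
  intro U hU
  obtain ⟨⟨R, hR⟩, hlim⟩ := wLim_of_isLUB eM hx hs hU
  have hR' : ∀ᶠ p : s in (U : Filter s), ‖Φ p‖ ≤ R :=
    hR.mono fun p hp => (H.norm_map_le hΦ p).trans hp
  obtain ⟨n, hn, -⟩ := WLim.exists eN hR'
  have h1 := H.rel_of_wLim eB (Eventually.of_forall fun p : s => hΦ p) hR hR' hlim hn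
  have h2 := (wCont_of_isNormalPosFunctional eN hω).tendsto hR' hn
  rwa [h1.unique H.faithful (hΦ x)] at h2

end Conclusion

end FreeFactor

/-- **Lemma (vNCondExpA).**  Let `B` be a unital von Neumann algebra, `I` a set, and for
every `i ∈ I` let `A i` be a unital von Neumann algebra containing a copy of `B` as a
unital von Neumann subalgebra (via `jB i`), with a normal conditional expectation
`φ i : A i → B` whose GNS representation is faithful.  Let
`(M, E) = (⋆̄_B)_{i ∈ I}(A i, φ i)` be the amalgamated free product of von Neumann
algebras.  Then for every `i₀ ∈ I` there exists a *normal* conditional expectation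
`Φ : M → A i₀` such that `Φ` restricted to `A i` equals `φ i` for every `i ≠ i₀`, and
`Φ (a 1 * a 2 * ⋯ * a n) = 0` whenever `n ≥ 2`, `a j ∈ A (ι j)` with
`φ (ι j) (a j) = 0` and `ι 1 ≠ ι 2, …, ι (n-1) ≠ ι n`. -/
theorem exists_normal_condExp_onto_free_factor
    {I : Type*} (B : Type*) [CStarAlgebra B] [PartialOrder B] [StarOrderedRing B]
    [WStarAlgebra B] (A : I → Type*) [∀ i, CStarAlgebra (A i)] [∀ i, PartialOrder (A i)]
    [∀ i, StarOrderedRing (A i)] [∀ i, WStarAlgebra (A i)]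
    (jB : ∀ i, B →⋆ₐ[ℂ] A i) (φ : ∀ i, A i →ₗ[ℂ] B)
    (hce : ∀ i, IsCondExp (jB i) (φ i)) (hnormal : ∀ i, IsNormalMap (φ i))
    (hfaith : ∀ i, FaithfulGNS (φ i))
    {M : Type*} [CStarAlgebra M] [PartialOrder M] [StarOrderedRing M] [WStarAlgebra M]
    (jC : B →⋆ₐ[ℂ] M) (emb : ∀ i, A i →⋆ₐ[ℂ] M) (E : M →ₗ[ℂ] B)
    (hprod : IsVNAmalgProd B jB φ jC emb E) (i₀ : I) :
    ∃ Φ : M →ₗ[ℂ] A i₀,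
      IsCondExp (emb i₀) Φ ∧ IsNormalMap Φ ∧
      (∀ i, i ≠ i₀ → ∀ a : A i, Φ (emb i a) = jB i₀ (φ i a)) ∧
      (∀ (n : ℕ) (ι : Fin (n + 2) → I), (∀ k : Fin (n + 1), ι k.castSucc ≠ ι k.succ) →
        ∀ a : (j : Fin (n + 2)) → A (ι j), (∀ j, φ (ι j) (a j) = 0) →
          Φ ((List.ofFn fun j => emb (ι j) (a j)).prod) = 0) := by
  obtain ⟨X, _, _, _, ⟨eM⟩⟩ := WStarAlgebra.exists_predual (M := M)
  obtain ⟨Y, _, _, _, ⟨eN⟩⟩ := WStarAlgebra.exists_predual (M := A i₀)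
  obtain ⟨Z, _, _, _, ⟨eB⟩⟩ := WStarAlgebra.exists_predual (M := B)
  have H : FreeFactor.NormalPair E (φ i₀) (emb i₀) :=
    { normal_left := hprod.normal
      normal_right := hnormal i₀
      nonneg_left := hprod.condExp.map_nonneg
      nonneg_right := (hce i₀).map_nonneg
      norm_left := hprod.condExp.contractive
      norm_right := (hce i₀).contractive
      restrict := hprod.restrict i₀
      faithful := hfaith i₀ }
  have hfree := FreeFactor.freeWords_of_free hprod.free
  obtain ⟨Φ, hΦ⟩ := FreeFactor.exists_linear_of_rel H.faithful
    (H.exists_rel eB eN eM (fun _ hx => FreeFactor.exists_rel_of_mem_adjoin hce hprod.condExp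
      hprod.compat hfree hprod.restrict i₀ hx) hprod.generating)
  have hword : ∀ l, FreeFactor.Alternating φ l → l ≠ [] → (∀ a : A i₀, l ≠ [⟨i₀, a⟩]) →
      Φ (FreeFactor.wordProd emb l) = 0 := fun l hl hne hi =>
    (hΦ _).unique H.faithful
      (FreeFactor.rel_word_zero hce hprod.condExp hprod.compat hfree hl hne hi)
  refine ⟨Φ, H.isCondExp hΦ (hprod.emb_injective i₀), H.isNormalMap hΦ eM eN eB,
    fun i hi a => ?_, fun n ι hι a ha => ?_⟩
  · obtain ⟨a', ha', hsum⟩ := FreeFactor.emb_eq_centered_add hce hprod.compat i a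
    have h1 := hword [⟨i, a'⟩] (FreeFactor.Alternating.nil.cons ha' (by simp)) (by simp)
      (fun b hb => hi (congrArg Sigma.fst (List.singleton_inj.1 hb)))
    rw [FreeFactor.wordProd_cons, FreeFactor.wordProd_nil, mul_one] at h1
    rw [hsum, map_add, h1, zero_add, ← hprod.compat i₀]
    exact H.map_emb hΦ _
  · rw [← FreeFactor.wordProd_ofFn]
    exact hword _ (FreeFactor.alternating_ofFn hι ha) (by simp) (by simp [List.ofFn_succ])
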